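/- arXiv:1406.2827 — 3 statements merged into one kernel-verified Lean document; each statement's English description precedes it below -/
import Mathlib

section
/- The presented group G_{5,3,6}(2,0) = ⟨P, Q, R | P⁵, Q³, R⁶, (PQ)², (QR)², (PQR)², (QR⁴)²⟩ is finite, of order 14400 (equal to 60 times the number 240 of ideal dodecahedra of the corresponding universal regular tessellation listed in Table 1). -/
/-- The relators of the presentation
⟨P, Q, R | P^p, Q^q, R^r, (PQ)², (QR)², (PQR)², (Q R^{r/2+1})^a (R Q R^{r/2})^b⟩
of the orientation-preserving symmetry group of the universal regular
tessellation of type {p,q,r} and cusp modulus a+bu, u = e^{2πi/r}.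
The generators P, Q, R are `FreeGroup.of 0`, `FreeGroup.of 1`, `FreeGroup.of 2`. -/
def tessRels (p q r a b : ℕ) : Set (FreeGroup (Fin 3)) :=
  {(FreeGroup.of 0) ^ p, (FreeGroup.of 1) ^ q, (FreeGroup.of 2) ^ r,
   (FreeGroup.of 0 * FreeGroup.of 1) ^ 2,
   (FreeGroup.of 1 * FreeGroup.of 2) ^ 2,
   (FreeGroup.of 0 * FreeGroup.of 1 * FreeGroup.of 2) ^ 2,
   (FreeGroup.of 1 * (FreeGroup.of 2) ^ (r / 2 + 1)) ^ a *
     (FreeGroup.of 2 * FreeGroup.of 1 * (FreeGroup.of 2) ^ (r / 2)) ^ b}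

/-- G_{p,q,r}(a,b), the presented group of the above presentation. -/
def tessGroup (p q r a b : ℕ) : Type := PresentedGroup (tessRels p q r a b)

instance (p q r a b : ℕ) : Group (tessGroup p q r a b) :=
  inferInstanceAs (Group (PresentedGroup _))

/-! ### Coset tables

A table `T : Fin 3 → List ℕ` lists the images of the points `0, 1, 2, …` under three generators.
It describes a coset action as soon as every edge of the Schreier graph follows from a
spanning tree by repeatedly completing relator cycles with a single missing edge. -/

namespace CosetTable

/-- The image of the point `i` under the generator `s`. -/
def act (T : Fin 3 → List ℕ) (s : Fin 3) (i : ℕ) : ℕ := (T s).getD i 0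

/-- The table is closed under the generators, satisfies the relators, and every generator ends
some relator (so that it acts injectively). -/
def IsAction (T : Fin 3 → List ℕ) (rels : List (List (Fin 3))) (n : ℕ) : Prop :=
  (∀ s, ∀ i < n, act T s i < n) ∧ (∀ w ∈ rels, ∀ i < n, w.foldr (act T) i = i) ∧
    ∀ s, ∃ w ∈ rels, w.getLast? = some s

instance (T rels n) : Decidable (IsAction T rels n) := by unfold IsAction; infer_instance

/-- The `i`-th edge of the tree leads from a point that is at most `i` to the point `i + 1`, along
one of the generators in `S`. -/
def IsTree (T : Fin 3 → List ℕ) (S : List (Fin 3)) (tree : List (Fin 3 × ℕ)) (n : ℕ) : Prop :=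
  tree.length + 1 = n ∧
    ∀ i (h : i < tree.length), tree[i].1 ∈ S ∧ tree[i].2 ≤ i ∧ act T tree[i].1 tree[i].2 = i + 1

instance (T S tree n) : Decidable (IsTree T S tree n) := by unfold IsTree; infer_instance

/-- Whether the edge labelled `s` from `i` belongs to the set of edges encoded by `m`. -/
def mem (m : ℕ) (s : Fin 3) (i : ℕ) : Bool := m.testBit (3 * i + s)

/-- Add the edge labelled `s` from `i` to the set of edges encoded by `m`. -/
def insert (m : ℕ) (s : Fin 3) (i : ℕ) : ℕ := m ||| 1 <<< (3 * i + s)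

/-- Follow a word, read from right to left, along known edges. -/
def walk (T : Fin 3 → List ℕ) (m : ℕ) : List (Fin 3) → ℕ → Option ℕ
  | [], i => some i
  | s :: v, i => (walk T m v i).bind fun j => if mem m s j then some (act T s j) else none

/-- Add the edge from `i` labelled by the first letter of the relator `w` if the rest of the
relator cycle is known. -/
def deduce (T : Fin 3 → List ℕ) (w : List (Fin 3)) (m i : ℕ) : ℕ :=
  match w with
  | [] => m
  | s :: v => if walk T m v (act T s i) = some i then insert m s i else m

/-- `List.foldl` on natural numbers, with the accumulator in weak head normal form at each step;
this bounds the recursion depth when the kernel evaluates it. -/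
def strictFoldl {α : Type*} (f : ℕ → α → ℕ) : ℕ → List α → ℕ
  | m, [] => m
  | m, a :: l =>
    match f m a with
    | 0 => strictFoldl f 0 l
    | k + 1 => strictFoldl f (k + 1) l

theorem strictFoldl_eq_foldl {α : Type*} (f : ℕ → α → ℕ) (m : ℕ) (l : List α) :
    strictFoldl f m l = l.foldl f m := by
  induction l generalizing m with
  | nil => rfl
  | cons a l ih =>
    rw [List.foldl_cons, ← ih, strictFoldl]
    split <;> simp_all

/-- Starting from the edges encoded by `m`, perform the given deductions; the triple `(k, r, l)`
stands for the `k`-th relator rotated by `r`, applied at the points of `l`. -/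
def closure (T : Fin 3 → List ℕ) (rels : List (List (Fin 3))) (ded : List (ℕ × ℕ × List ℕ))
    (m : ℕ) : ℕ :=
  strictFoldl (fun m d => strictFoldl (deduce T ((rels.getD d.1 []).rotate d.2.1)) m d.2.2) m ded

/-- The edges of the tree, and the loops at `0` labelled by `B`. -/
def initial (B : List (Fin 3)) (tree : List (Fin 3 × ℕ)) : ℕ :=
  strictFoldl (fun m e => insert m e.1 e.2) (strictFoldl (fun m s => insert m s 0) 0 B) tree

/-- The deductions yield all edges with labels in `S`, and `B` fixes `0`. -/
def IsComplete (T : Fin 3 → List ℕ) (rels : List (List (Fin 3))) (B S : List (Fin 3))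
    (tree : List (Fin 3 × ℕ)) (ded : List (ℕ × ℕ × List ℕ)) (n : ℕ) : Prop :=
  (∀ b ∈ B, b ∈ S ∧ act T b 0 = 0) ∧
    ∀ s ∈ S, ∀ i < n, mem (closure T rels ded (initial B tree)) s i

instance (T rels B S tree ded n) : Decidable (IsComplete T rels B S tree ded n) := by
  unfold IsComplete; infer_instance

theorem mem_insert {m : ℕ} {s t : Fin 3} {i j : ℕ} :
    mem (insert m s i) t j ↔ mem m t j ∨ (t = s ∧ j = i) := by
  have : 3 * j + (t : ℕ) = 3 * i + s ↔ t = s ∧ j = i := by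
    rw [Fin.ext_iff]; omega
  rw [← this, mem, insert, Nat.testBit_or, Nat.one_shiftLeft, Nat.testBit_two_pow, Bool.or_eq_true,
    decide_eq_true_eq, eq_comm (a := 3 * i + (s : ℕ)), mem]

section Sound

variable {G X : Type*} [Group G] [MulAction G X] {g : Fin 3 → G} {f : ℕ → X}
  {T : Fin 3 → List ℕ} {rels : List (List (Fin 3))}

/-- All edges encoded by `m` are respected by `f`. -/
def Sound (g : Fin 3 → G) (f : ℕ → X) (T : Fin 3 → List ℕ) (m : ℕ) : Prop :=
  ∀ s i, mem m s i → g s • f i = f (act T s i)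

theorem Sound.insert {m : ℕ} (hm : Sound g f T m) {s : Fin 3} {i : ℕ}
    (h : g s • f i = f (act T s i)) : Sound g f T (insert m s i) := by
  intro t j hj
  rcases mem_insert.1 hj with hj | ⟨rfl, rfl⟩
  exacts [hm t j hj, h]

theorem Sound.walk {m : ℕ} (hm : Sound g f T m) {w : List (Fin 3)} {i j : ℕ}
    (h : walk T m w i = some j) : (w.map g).prod • f i = f j := by
  induction w generalizing j with
  | nil => simp_all [CosetTable.walk]
  | cons s v ih =>
    obtain ⟨k, hk, hj⟩ := Option.bind_eq_some_iff.1 h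
    split_ifs at hj with hs
    obtain rfl := Option.some.inj hj
    rw [List.map_cons, List.prod_cons, mul_smul, ih hk, hm s k hs]

theorem Sound.deduce {m : ℕ} (hm : Sound g f T m) {w : List (Fin 3)}
    (hw : (w.map g).prod = 1) (i : ℕ) : Sound g f T (deduce T w m i) := by
  cases w with
  | nil => exact hm
  | cons s v =>
    rw [CosetTable.deduce]
    split_ifs with h
    · refine hm.insert ?_
      rw [← hm.walk h, ← mul_smul, ← List.prod_cons, ← List.map_cons, hw, one_smul]
    · exact hm

theorem Sound.closure (hrels : ∀ w ∈ rels, (w.map g).prod = 1) {m : ℕ} (hm : Sound g f T m)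
    (ded : List (ℕ × ℕ × List ℕ)) : Sound g f T (closure T rels ded m) := by
  simp only [CosetTable.closure, strictFoldl_eq_foldl]
  refine List.foldlRecOn _ _ hm fun m hm d _ => List.foldlRecOn _ _ hm fun m hm i _ =>
    hm.deduce ?_ i
  rw [List.map_rotate]
  refine List.prod_rotate_eq_one_of_prod_eq_one ?_ _
  rw [List.getD_eq_getElem?_getD]
  rcases h : rels[d.1]? with _ | w
  · simp
  · exact hrels w (List.mem_of_getElem? h)

theorem Sound.initial {B : List (Fin 3)} {tree : List (Fin 3 × ℕ)}
    (hB : ∀ b ∈ B, g b • f 0 = f (act T b 0))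
    (htree : ∀ e ∈ tree, g e.1 • f e.2 = f (act T e.1 e.2)) : Sound g f T (initial B tree) := by
  simp only [CosetTable.initial, strictFoldl_eq_foldl]
  refine List.foldlRecOn _ _ (List.foldlRecOn _ _ ?_ fun m hm b hb => hm.insert (hB b hb))
    fun m hm e he => hm.insert (htree e he)
  intro s i h
  simp [mem] at h

end Sound

/-- The extension of a base point along the edges of a tree. -/
def extend {G X : Type*} [SMul G X] (g : Fin 3 → G) (x : X) (tree : List (Fin 3 × ℕ)) : ℕ → X
  | 0 => x
  | i + 1 => g (tree.getD i (0, 0)).1 • extend g x tree (min (tree.getD i (0, 0)).2 i)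

theorem extend_act {G X : Type*} [SMul G X] (g : Fin 3 → G) (x : X) {T : Fin 3 → List ℕ}
    {S : List (Fin 3)} {tree : List (Fin 3 × ℕ)} {n : ℕ} (h : IsTree T S tree n) :
    ∀ e ∈ tree, g e.1 • extend g x tree e.2 = extend g x tree (act T e.1 e.2) := by
  intro e he
  obtain ⟨i, hi, rfl⟩ := List.getElem_of_mem he
  obtain ⟨-, hle, hact⟩ := h.2 i hi
  rw [hact, extend, List.getD_eq_getElem _ _ hi, min_eq_left hle]

/-- The permutation of `Fin n` given by a generator. -/
noncomputable def perm {T : Fin 3 → List ℕ} {rels : List (List (Fin 3))} {n : ℕ}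
    (h : IsAction T rels n) (s : Fin 3) : Equiv.Perm (Fin n) :=
  Equiv.ofBijective (fun i => ⟨act T s i, h.1 s i i.2⟩) <| Finite.injective_iff_bijective.1 <| by
    obtain ⟨w, hw, hs⟩ := h.2.2 s
    obtain ⟨v, rfl⟩ := List.getLast?_eq_some_iff.1 hs
    intro i j hij
    have key := fun i : Fin n => h.2.1 _ hw i i.2
    simp only [List.foldr_append, List.foldr_cons, List.foldr_nil] at key
    have hval : act T s i = act T s j := Fin.val_eq_of_eq hij
    rw [Fin.ext_iff, ← key i, ← key j, hval]

theorem perm_apply {T : Fin 3 → List ℕ} {rels : List (List (Fin 3))} {n : ℕ}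
    (h : IsAction T rels n) (s : Fin 3) (i : Fin n) : (perm h s i : ℕ) = act T s i := rfl

theorem prod_map_perm {T : Fin 3 → List ℕ} {rels : List (List (Fin 3))} {n : ℕ}
    (h : IsAction T rels n) {w : List (Fin 3)} (hw : w ∈ rels) : (w.map (perm h)).prod = 1 := by
  have key (v : List (Fin 3)) (i : Fin n) :
      ((v.map (perm h)).prod i : ℕ) = v.foldr (act T) i := by
    induction v with
    | nil => rfl
    | cons s v ih =>
      rw [List.map_cons, List.prod_cons, Equiv.Perm.mul_apply, perm_apply, ih, List.foldr_cons]
  ext i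
  exact (key w i).trans (h.2.1 w hw i i.2)

/-- If an action of `G` on `n` points is given by a table all of whose edges labelled by `S` can
be deduced from the relators, then the subgroup generated by `B` has index `n` in the one
generated by `S`. -/
theorem relIndex_eq {G : Type*} [Group G] {g : Fin 3 → G} {T : Fin 3 → List ℕ}
    {rels : List (List (Fin 3))} {B S : List (Fin 3)} {tree : List (Fin 3 × ℕ)}
    {ded : List (ℕ × ℕ × List ℕ)} {n : ℕ} (hrels : ∀ w ∈ rels, (w.map g).prod = 1)
    (φ : G →* Equiv.Perm (Fin n)) (hφ : ∀ s i, (φ (g s) i : ℕ) = act T s i)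
    (htree : IsTree T S tree n) (hded : IsComplete T rels B S tree ded n) :
    (Subgroup.closure (g '' {s | s ∈ B})).relIndex (Subgroup.closure (g '' {s | s ∈ S})) = n := by
  set K := Subgroup.closure (g '' {s | s ∈ B}) with hK
  set H := Subgroup.closure (g '' {s | s ∈ S}) with hH
  have hn : 0 < n := htree.1 ▸ Nat.succ_pos _
  let o : Fin n := ⟨0, hn⟩
  let f : ℕ → G ⧸ K := extend g ((1 : G) : G ⧸ K) tree
  have hf0 : f 0 = ((1 : G) : G ⧸ K) := by simp [f, extend]
  have mk_eq_one {x : G} : x • ((1 : G) : G ⧸ K) = ((1 : G) : G ⧸ K) ↔ x ∈ K := by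
    rw [MulAction.Quotient.smul_coe, smul_eq_mul, mul_one, eq_comm, QuotientGroup.eq, inv_one,
      one_mul]
  have hgS : ∀ s ∈ S, g s ∈ H := fun s hs => Subgroup.subset_closure ⟨s, hs, rfl⟩
  have hf : ∀ s ∈ S, ∀ i : Fin n, g s • f i = f (φ (g s) i) := by
    intro s hs i
    rw [hφ]
    refine Sound.closure hrels (Sound.initial (fun b hb => ?_) (extend_act g _ htree)) ded s i
      (hded.2 s hs i i.2)
    change g b • f 0 = f (act T b 0)
    rw [(hded.1 b hb).2, hf0]
    exact mk_eq_one.2 (Subgroup.subset_closure ⟨b, hb, rfl⟩)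
  have hfH : ∀ h ∈ H, ∀ i : Fin n, h • f i = f (φ h i) := by
    intro h hh
    induction hh using Subgroup.closure_induction with
    | mem x hx => obtain ⟨s, hs, rfl⟩ := hx; exact hf s hs
    | one => simp
    | mul x y _ _ hx hy => intro i; rw [mul_smul, hy, hx, map_mul, Equiv.Perm.mul_apply]
    | inv x _ hx => intro i; rw [inv_smul_eq_iff, hx, map_inv, ← Equiv.Perm.mul_apply, mul_inv_cancel,
        Equiv.Perm.one_apply]
  let _ : MulAction H (Fin n) := MulAction.compHom _ (φ.comp H.subtype)
  have hsmul (h : H) (i : Fin n) : h • i = φ h i := rfl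
  have hstab : MulAction.stabilizer H o = K.subgroupOf H := by
    ext h
    rw [MulAction.mem_stabilizer_iff, Subgroup.mem_subgroupOf, hsmul]
    constructor
    · intro h0
      have hfix := hfH h h.2 o
      rw [h0, show f o = _ from hf0] at hfix
      exact mk_eq_one.1 hfix
    · suffices K ≤ (MulAction.stabilizer (Equiv.Perm (Fin n)) o).comap φ from fun hh => this hh
      rw [hK, Subgroup.closure_le]
      rintro _ ⟨b, hb, rfl⟩
      exact Fin.ext ((hφ b o).trans (hded.1 b hb).2)
  have hreach : ∀ i : ℕ, ∀ hi : i < n, ∃ h : H, h • o = ⟨i, hi⟩ := by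
    intro i
    induction i using Nat.strong_induction_on with
    | h i ih =>
      intro hi
      rcases i with _ | i
      · exact ⟨1, one_smul _ _⟩
      · have hlt : i < tree.length := by have := htree.1; omega
        obtain ⟨hS, hle, hact⟩ := htree.2 i hlt
        obtain ⟨h, hh⟩ := ih _ (Nat.lt_succ_of_le hle) (by omega)
        refine ⟨⟨_, hgS _ hS⟩ * h, ?_⟩
        rw [mul_smul, hh, hsmul]
        exact Fin.ext ((hφ _ _).trans hact)
  have : MulAction.IsPretransitive H (Fin n) :=
    (MulAction.isPretransitive_iff_base o).2 fun i => hreach i i.2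
  rw [Subgroup.relIndex, ← hstab, MulAction.index_stabilizer_of_transitive, Nat.card_fin]

end CosetTable

/-- The permutations by which `P`, `Q`, `R` act on the 240 cosets of `⟨P, Q⟩`. -/
def dodecahedronTable : Fin 3 → List ℕ :=
  ![
    [0, 2, 5, 3, 4, 7, 13, 10, 8, 17, 1, 18, 16, 14, 9, 11, 21, 6, 25, 27, 29, 31, 15, 19, 30, 22,
    35, 37, 23, 39, 36, 42, 26, 43, 34, 46, 40, 28, 32, 52, 41, 24, 12, 56, 44, 59, 38, 63, 50,
    20, 33, 55, 49, 51, 54, 47, 48, 72, 69, 74, 60, 76, 65, 53, 70, 82, 45, 61, 79, 57, 86, 62,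
    73, 58, 75, 66, 91, 87, 93, 94, 67, 77, 97, 95, 92, 83, 98, 100, 102, 64, 68, 80, 107, 108,
    110, 111, 99, 71, 89, 116, 103, 84, 119, 81, 106, 113, 121, 117, 120, 85, 90, 109, 78, 127,
    128, 115, 131, 101, 96, 135, 112, 138, 104, 105, 132, 125, 88, 141, 142, 129, 145, 118, 148,
    134, 114, 126, 137, 124, 122, 139, 143, 123, 133, 158, 140, 160, 152, 150, 136, 156, 167, 164,
    170, 130, 147, 146, 174, 154, 159, 144, 161, 153, 171, 168, 179, 155, 162, 157, 180, 163, 165,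
    175, 182, 183, 184, 186, 188, 149, 151, 191, 192, 185, 194, 195, 177, 198, 166, 173, 200, 181,
    176, 178, 169, 172, 201, 199, 206, 197, 205, 187, 204, 193, 209, 203, 190, 189, 216, 207, 219,
    220, 211, 196, 213, 202, 214, 217, 210, 225, 215, 227, 212, 224, 229, 208, 230, 226, 218, 228,
    223, 233, 234, 221, 222, 235, 231, 232, 236, 237, 238, 239],
    [0, 4, 7, 9, 10, 12, 14, 16, 8, 17, 1, 13, 21, 22, 15, 6, 2, 3, 25, 28, 30, 5, 11, 23, 24, 34,
    37, 38, 32, 40, 41, 42, 19, 27, 18, 48, 49, 50, 33, 53, 51, 20, 54, 46, 58, 60, 62, 52, 65,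
    55, 26, 29, 67, 61, 31, 36, 71, 73, 69, 75, 66, 39, 43, 80, 57, 35, 45, 47, 59, 44, 72, 82,
    89, 64, 90, 68, 63, 81, 83, 74, 76, 84, 56, 85, 77, 78, 98, 101, 95, 70, 79, 91, 103, 109,
    110, 112, 87, 97, 115, 117, 118, 96, 120, 104, 92, 93, 100, 122, 123, 105, 125, 126, 88, 111,
    107, 86, 133, 134, 106, 136, 137, 131, 114, 124, 108, 94, 113, 135, 138, 144, 139, 147, 141,
    150, 99, 146, 152, 102, 154, 153, 129, 155, 157, 159, 140, 161, 127, 121, 165, 143, 116, 145,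
    119, 130, 128, 132, 158, 167, 177, 149, 178, 151, 162, 163, 160, 170, 173, 142, 169, 172, 148,
    166, 168, 171, 184, 187, 180, 156, 164, 191, 193, 175, 192, 186, 197, 199, 189, 181, 201, 183,
    182, 203, 190, 176, 204, 205, 195, 174, 210, 211, 212, 213, 194, 179, 202, 196, 198, 218, 214,
    200, 206, 185, 209, 188, 223, 207, 216, 226, 215, 228, 220, 217, 219, 208, 225, 231, 221, 232,
    222, 227, 234, 224, 229, 235, 237, 236, 233, 230, 238, 239],
    [1, 3, 6, 8, 0, 11, 2, 15, 17, 10, 9, 19, 20, 21, 16, 23, 24, 4, 26, 13, 28, 30, 32, 14, 7,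
    33, 36, 18, 22, 27, 5, 29, 41, 44, 45, 47, 31, 34, 51, 43, 54, 12, 55, 57, 42, 40, 61, 59, 64,
    50, 58, 66, 65, 68, 69, 60, 70, 35, 38, 39, 25, 77, 78, 79, 81, 83, 49, 84, 85, 37, 87, 88,
    82, 62, 76, 67, 92, 52, 75, 95, 96, 53, 93, 46, 73, 48, 99, 63, 103, 104, 105, 106, 72, 74,
    102, 56, 109, 113, 114, 108, 91, 89, 107, 80, 112, 101, 111, 86, 94, 71, 124, 97, 90, 100,
    129, 130, 132, 115, 126, 128, 125, 127, 137, 134, 139, 140, 118, 121, 143, 110, 120, 146, 145,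
    149, 144, 147, 151, 153, 152, 98, 117, 150, 156, 116, 122, 119, 162, 163, 164, 166, 168, 169,
    171, 123, 172, 173, 175, 176, 167, 154, 170, 155, 135, 131, 180, 181, 136, 182, 138, 133, 183,
    141, 161, 159, 185, 148, 186, 189, 190, 188, 142, 192, 160, 158, 196, 194, 165, 177, 195, 193,
    187, 202, 157, 178, 179, 174, 207, 208, 209, 197, 206, 203, 214, 215, 211, 213, 217, 191, 201,
    219, 221, 218, 222, 223, 184, 199, 224, 198, 205, 200, 229, 228, 226, 204, 227, 216, 210, 220,
    212, 225, 233, 232, 231, 230, 236, 237, 238, 239, 235, 234]]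

/-- A spanning tree of the Schreier graph given by `dodecahedronTable`. -/
def dodecahedronTree : List (Fin 3 × ℕ) :=
  [(2, 0), (0, 1), (2, 1), (1, 1), (0, 2), (2, 2), (1, 2), (2, 3), (1, 3), (1, 4), (2, 5), (1, 5),
  (0, 6), (1, 6), (2, 7), (1, 7), (2, 8), (0, 11), (2, 11), (2, 12), (1, 12), (1, 13), (2, 15),
  (2, 16), (0, 18), (2, 18), (0, 19), (1, 19), (0, 20), (1, 20), (0, 21), (2, 22), (2, 25),
  (1, 25), (0, 26), (2, 26), (1, 26), (1, 27), (0, 29), (1, 29), (1, 30), (0, 31), (0, 33),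
  (2, 33), (2, 34), (0, 35), (2, 35), (1, 35), (1, 36), (1, 37), (2, 38), (0, 39), (1, 39),
  (2, 40), (2, 42), (0, 43), (2, 43), (1, 44), (0, 45), (1, 45), (2, 46), (1, 46), (0, 47),
  (2, 48), (1, 48), (2, 51), (1, 52), (2, 53), (2, 54), (2, 56), (1, 56), (0, 57), (1, 57),
  (0, 59), (1, 59), (0, 61), (2, 61), (2, 62), (2, 63), (1, 63), (2, 64), (0, 65), (2, 65),
  (2, 67), (2, 68), (0, 70), (2, 70), (2, 71), (1, 72), (1, 74), (0, 76), (2, 76), (0, 78),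
  (0, 79), (2, 79), (2, 80), (0, 82), (0, 86), (2, 86), (0, 87), (1, 87), (0, 88), (2, 88),
  (2, 89), (2, 90), (2, 91), (0, 92), (0, 93), (1, 93), (0, 94), (0, 95), (1, 95), (2, 97),
  (2, 98), (1, 98), (0, 99), (1, 99), (1, 100), (0, 102), (1, 102), (0, 106), (1, 107), (1, 108),
  (2, 110), (1, 110), (1, 111), (0, 113), (0, 114), (2, 114), (2, 115), (0, 116), (2, 116),
  (1, 116), (1, 117), (0, 119), (1, 119), (1, 120), (0, 121), (2, 124), (2, 125), (0, 127),
  (0, 128), (2, 128), (1, 129), (0, 130), (2, 131), (1, 131), (0, 132), (2, 133), (1, 133),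
  (2, 136), (1, 136), (2, 137), (1, 138), (1, 141), (2, 142), (1, 142), (0, 143), (1, 143),
  (0, 145), (1, 145), (2, 146), (2, 147), (2, 148), (1, 148), (2, 149), (0, 150), (2, 150),
  (2, 151), (0, 152), (2, 152), (2, 154), (2, 155), (0, 156), (2, 156), (2, 157), (1, 158),
  (1, 160), (0, 164), (2, 164), (2, 165), (2, 167), (2, 170), (0, 174), (2, 174), (0, 175),
  (1, 175), (0, 176), (2, 177), (2, 178), (0, 179), (0, 180), (1, 180), (0, 182), (0, 183),
  (2, 184), (1, 184), (0, 185), (1, 185), (0, 188), (1, 188), (2, 191), (1, 191), (1, 194),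
  (1, 195), (0, 196), (2, 196), (2, 197), (2, 198), (1, 198), (1, 199), (1, 200), (1, 201),
  (2, 202), (2, 203), (0, 206), (2, 206), (1, 207), (0, 208), (0, 209), (2, 210), (2, 212),
  (2, 213), (2, 216), (0, 217), (1, 217), (0, 219), (1, 219), (2, 220), (0, 224), (1, 225),
  (1, 227), (0, 229), (0, 230), (0, 233), (2, 234), (1, 234), (2, 236), (2, 237)]

/-- Deductions filling in `dodecahedronTable` from `dodecahedronTree`. -/
def dodecahedronDeductions : List (ℕ × ℕ × List ℕ) :=
  [
    (1, 0, [10, 16, 21, 41, 50, 65, 134, 137, 150, 152, 211, 213]),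
    (3, 0, [7, 12, 40, 48, 62, 133, 136, 147, 210, 212]),
    (4, 1, [4, 9, 14, 30, 49, 60]),
    (5, 0, [4, 14]),
    (3, 0, [10]),
    (0, 0, [5]),
    (3, 0, [16]),
    (0, 0, [42]),
    (3, 1, [31]),
    (2, 0, [17]),
    (6, 0, [8, 17]),
    (1, 0, [9]),
    (3, 0, [17]),
    (4, 1, [10]),
    (5, 0, [9]),
    (3, 0, [3]),
    (0, 0, [13]),
    (5, 0, [8]),
    (5, 1, [11]),
    (1, 0, [22]),
    (4, 1, [13, 28]),
    (5, 0, [37]),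
    (5, 1, [15]),
    (1, 0, [14]),
    (3, 0, [15, 22]),
    (4, 1, [6]),
    (6, 2, [23, 24]),
    (4, 0, [23, 24]),
    (5, 0, [24, 28]),
    (3, 0, [23, 41]),
    (0, 0, [25, 27]),
    (5, 2, [19, 21]),
    (3, 1, [18]),
    (1, 0, [34]),
    (4, 1, [37, 41]),
    (6, 2, [20, 32]),
    (4, 0, [28, 32]),
    (3, 0, [32, 34, 38]),
    (5, 2, [27, 29, 31]),
    (4, 0, [33, 51, 54]),
    (1, 0, [38, 40, 42]),
    (3, 0, [50, 53, 54]),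
    (0, 0, [46, 56]),
    (3, 1, [43, 82]),
    (1, 0, [62, 71]),
    (4, 1, [58, 73]),
    (5, 0, [49, 60, 73]),
    (3, 0, [30, 71]),
    (0, 0, [36, 52, 97]),
    (5, 1, [47, 55]),
    (1, 0, [49, 67]),
    (3, 0, [51, 55, 80]),
    (4, 1, [36, 52]),
    (6, 2, [44, 45, 66, 69]),
    (4, 0, [66, 69]),
    (1, 0, [58, 60]),
    (3, 0, [66, 69, 75]),
    (5, 2, [39, 47, 55, 59]),
    (4, 0, [61, 68]),
    (1, 0, [53, 75]),
    (3, 0, [67, 90]),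
    (0, 0, [63, 74, 91]),
    (3, 1, [76, 97]),
    (4, 1, [50, 75]),
    (5, 0, [44, 58]),
    (5, 2, [57, 74]),
    (6, 2, [77, 78, 81, 83, 84]),
    (4, 0, [64, 77, 78, 79, 84, 85]),
    (1, 0, [73, 80, 81, 83, 90]),
    (3, 0, [68, 89, 109]),
    (5, 0, [81, 85, 112]),
    (4, 1, [85, 112]),
    (5, 2, [72, 82, 93]),
    (4, 0, [70, 105]),
    (1, 0, [89, 109]),
    (3, 0, [83, 123]),
    (0, 0, [72, 110, 111]),
    (3, 1, [91, 94]),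
    (4, 1, [101, 109]),
    (5, 2, [95, 108]),
    (4, 0, [88, 124]),
    (1, 0, [112, 123, 125]),
    (3, 0, [64, 120, 125, 126]),
    (0, 0, [98, 108, 135]),
    (5, 2, [94, 111, 120]),
    (2, 0, [87, 92]),
    (5, 0, [77, 84, 101, 117]),
    (4, 0, [96, 104, 113]),
    (3, 0, [105, 118, 122, 137]),
    (6, 3, [96, 104, 105, 103]),
    (4, 0, [92, 101, 103]),
    (5, 2, [100, 102, 113]),
    (3, 0, [96, 103]),
    (0, 0, [100, 107, 131, 141]),
    (1, 0, [126]),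
    (3, 1, [86, 127]),
    (4, 1, [118, 122]),
    (5, 2, [99, 107]),
    (4, 0, [106, 114]),
    (1, 0, [115, 118, 122]),
    (3, 0, [104, 115, 134]),
    (4, 1, [117, 123, 144]),
    (6, 2, [106, 129, 130, 139, 140, 153]),
    (4, 0, [130, 139, 140, 153]),
    (5, 0, [129, 139, 144, 153, 159]),
    (0, 0, [138, 142]),
    (3, 1, [121, 128, 167]),
    (1, 0, [144, 147, 154, 157]),
    (3, 0, [140, 154, 157, 161]),
    (4, 1, [126, 134, 159]),
    (5, 2, [119, 121, 127, 143, 145]),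
    (4, 0, [146, 149, 151]),
    (1, 0, [135, 159, 161]),
    (3, 0, [146, 155, 177, 178]),
    (0, 0, [158, 160, 167]),
    (4, 1, [135, 138]),
    (6, 2, [162, 163, 166]),
    (4, 0, [162, 163, 171]),
    (2, 0, [132, 169]),
    (5, 0, [124, 166]),
    (5, 1, [132, 156]),
    (1, 0, [155, 177]),
    (4, 1, [141, 158, 161, 187]),
    (6, 2, [168, 171, 172, 173]),
    (4, 0, [166, 168, 169, 172, 173]),
    (5, 0, [162, 163, 169, 199]),
    (3, 0, [149, 165]),
    (0, 0, [148, 170, 184]),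
    (3, 1, [170, 174]),
    (1, 0, [165, 197]),
    (3, 0, [197]),
    (4, 1, [199]),
    (5, 0, [187]),
    (3, 0, [171]),
    (5, 2, [160, 175]),
    (4, 0, [164, 181]),
    (1, 0, [178, 187]),
    (3, 0, [151, 181]),
    (0, 0, [186, 191]),
    (3, 1, [179]),
    (1, 0, [203]),
    (3, 0, [203]),
    (4, 1, [193]),
    (6, 2, [183, 190]),
    (2, 0, [180, 182, 189]),
    (5, 0, [168, 172, 173, 193]),
    (4, 0, [176, 189, 190]),
    (5, 2, [186, 192, 194, 195]),
    (4, 0, [182, 183, 196, 202]),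
    (1, 0, [186, 192, 193, 204, 205]),
    (3, 0, [189, 190, 192, 201, 204, 205]),
    (0, 0, [194, 195, 198, 200]),
    (5, 2, [179, 185, 188, 201]),
    (6, 2, [176, 181, 207, 208, 214, 215]),
    (4, 0, [208, 215, 223]),
    (3, 0, [211, 213, 228]),
    (4, 1, [204, 205, 218]),
    (5, 0, [207, 214, 218, 226]),
    (1, 0, [214, 218]),
    (3, 0, [215, 223]),
    (0, 0, [216, 225, 227]),
    (4, 1, [211, 223]),
    (5, 2, [217, 219]),
    (4, 0, [221, 222]),
    (1, 0, [226, 228]),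
    (3, 0, [231, 232]),
    (3, 1, [206]),
    (1, 0, [210]),
    (3, 1, [216]),
    (5, 2, [200, 225]),
    (4, 0, [209, 224]),
    (1, 0, [212, 231]),
    (3, 0, [202, 221]),
    (0, 0, [220, 234]),
    (3, 1, [220, 230]),
    (5, 2, [209, 226, 227]),
    (1, 0, [237]),
    (3, 0, [237]),
    (4, 0, [229]),
    (1, 0, [232]),
    (3, 0, [222]),
    (4, 1, [228]),
    (6, 2, [221, 222]),
    (5, 2, [224, 229]),
    (4, 1, [231, 232]),
    (0, 0, [235]),
    (3, 1, [233]),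
    (5, 2, [230, 233]),
    (4, 0, [236]),
    (1, 0, [235]),
    (3, 0, [236]),
    (4, 1, [235]),
    (6, 2, [238, 239]),
    (4, 0, [238, 239]),
    (5, 0, [238, 239])]

/-- The permutations by which `P`, `Q`, `R` act on the 12 faces of a dodecahedron, through a
quotient of the group isomorphic to `A₅`; the stabilizer of a face in `⟨P, Q⟩` is `⟨P⟩`. -/
def faceTable : Fin 3 → List ℕ :=
  ![
    [0, 2, 3, 4, 5, 1, 7, 8, 9, 10, 6, 11],
    [1, 2, 0, 5, 6, 7, 8, 3, 4, 10, 11, 9],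
    [10, 5, 4, 9, 11, 6, 1, 0, 3, 8, 7, 2]]

/-- A spanning tree of the Schreier graph of `P` and `Q` given by `faceTable`. -/
def faceTree : List (Fin 3 × ℕ) :=
  [(1, 0), (0, 1), (0, 2), (0, 3), (1, 3), (1, 4), (1, 5), (1, 6), (0, 8), (0, 9), (1, 10)]

/-- Deductions filling in the first two rows of `faceTable` from `faceTree`. -/
def faceDeductions : List (ℕ × ℕ × List ℕ) :=
  [
    (1, 0, [7, 8]),
    (3, 0, [6]),
    (3, 1, [2]),
    (1, 0, [1]),
    (3, 0, [5]),
    (0, 0, [4]),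
    (3, 0, [7]),
    (0, 0, [10]),
    (3, 1, [9]),
    (1, 0, [11]),
    (3, 0, [11])]

/-- The relators of `G_{5,3,6}(2,0)`, as words in the generators. -/
def tessWords536 : List (List (Fin 3)) :=
  [[0, 0, 0, 0, 0], [1, 1, 1], [2, 2, 2, 2, 2, 2], [0, 1, 0, 1], [1, 2, 1, 2], [0, 1, 2, 0, 1, 2],
    [1, 2, 2, 2, 2, 1, 2, 2, 2, 2]]

theorem tessRels_536 :
    tessRels 5 3 6 2 0 = {r | ∃ w ∈ tessWords536, (w.map FreeGroup.of).prod = r} := by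
  ext r
  simp [tessRels, tessWords536, pow_succ, mul_assoc, eq_comm]

theorem isAction_dodecahedronTable :
    CosetTable.IsAction dodecahedronTable tessWords536 240 := by decide +kernel

theorem isAction_faceTable : CosetTable.IsAction faceTable tessWords536 12 := by decide +kernel

theorem isTree_dodecahedronTree :
    CosetTable.IsTree dodecahedronTable [0, 1, 2] dodecahedronTree 240 := by decide +kernel

theorem isTree_faceTree : CosetTable.IsTree faceTable [0, 1] faceTree 12 := by decide +kernel

theorem isComplete_dodecahedronDeductions :
    CosetTable.IsComplete dodecahedronTable tessWords536 [0, 1] [0, 1, 2] dodecahedronTree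
      dodecahedronDeductions 240 := by decide +kernel

theorem isComplete_faceDeductions :
    CosetTable.IsComplete faceTable tessWords536 [0] [0, 1] faceTree faceDeductions 12 := by
  decide +kernel

/-- The generators of `G_{5,3,6}(2,0)`. -/
def tessGen536 : Fin 3 → tessGroup 5 3 6 2 0 := PresentedGroup.of

theorem prod_map_tessGen536 {w : List (Fin 3)} (hw : w ∈ tessWords536) :
    (w.map tessGen536).prod = 1 := by
  have h : (w.map FreeGroup.of).prod ∈ tessRels 5 3 6 2 0 := tessRels_536 ▸ ⟨w, hw, rfl⟩
  have h := PresentedGroup.one_of_mem h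
  rwa [map_list_prod, List.map_map] at h

theorem exists_hom_perm {T : Fin 3 → List ℕ} {n : ℕ} (h : CosetTable.IsAction T tessWords536 n) :
    ∃ φ : tessGroup 5 3 6 2 0 →* Equiv.Perm (Fin n),
      ∀ s i, (φ (tessGen536 s) i : ℕ) = CosetTable.act T s i := by
  have hrels : ∀ r ∈ tessRels 5 3 6 2 0, FreeGroup.lift (CosetTable.perm h) r = 1 := by
    rw [tessRels_536]
    rintro _ ⟨w, hw, rfl⟩
    rw [map_list_prod, List.map_map, ← CosetTable.prod_map_perm h hw]
    congr 2
  refine ⟨PresentedGroup.toGroup hrels, fun s i => ?_⟩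
  rw [← CosetTable.perm_apply h]
  exact congrArg Fin.val (congrArg (· i) (PresentedGroup.toGroup.of hrels))

theorem orderOf_tessGen536_zero : orderOf (tessGen536 0) = 5 := by
  have : Fact (Nat.Prime 5) := ⟨by norm_num⟩
  refine orderOf_eq_prime ?_ fun h1 => ?_
  · simpa [pow_succ, mul_assoc] using
      prod_map_tessGen536 (w := [0, 0, 0, 0, 0]) (by simp [tessWords536])
  · obtain ⟨φ, hφ⟩ := exists_hom_perm isAction_faceTable
    have := hφ 0 1
    rw [h1, map_one φ] at this
    exact absurd this (by decide)

theorem card_tessGroup_536 : Nat.card (tessGroup 5 3 6 2 0) = 14400 := by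
  obtain ⟨φ, hφ⟩ := exists_hom_perm isAction_dodecahedronTable
  obtain ⟨ψ, hψ⟩ := exists_hom_perm isAction_faceTable
  have h240 := CosetTable.relIndex_eq (fun _ => prod_map_tessGen536) φ hφ isTree_dodecahedronTree
    isComplete_dodecahedronDeductions
  have h12 := CosetTable.relIndex_eq (fun _ => prod_map_tessGen536) ψ hψ isTree_faceTree
    isComplete_faceDeductions
  have h5 : (⊥ : Subgroup _).relIndex (Subgroup.closure (tessGen536 '' {s | s ∈ [0]})) = 5 := by
    simp [Subgroup.relIndex_bot_left, ← Subgroup.zpowers_eq_closure, orderOf_tessGen536_zero]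
  have htop : Subgroup.closure (tessGen536 '' {s | s ∈ [0, 1, 2]}) = ⊤ := by
    rw [show {s : Fin 3 | s ∈ [0, 1, 2]} = Set.univ by ext s; fin_cases s <;> simp, Set.image_univ]
    exact PresentedGroup.closure_range_of _
  have hle {B S : List (Fin 3)} (h : B ⊆ S) : Subgroup.closure (tessGen536 '' {s | s ∈ B}) ≤
      Subgroup.closure (tessGen536 '' {s | s ∈ S}) :=
    Subgroup.closure_mono (Set.image_mono h)
  rw [← Subgroup.card_top, ← Subgroup.relIndex_bot_left, ← htop,
    ← Subgroup.relIndex_mul_relIndex _ _ _ bot_le (hle (B := [0, 1]) (by simp)),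
    ← Subgroup.relIndex_mul_relIndex _ _ _ bot_le (hle (B := [0]) (S := [0, 1]) (by simp)),
    h5, h12, h240]

/-- the dodecahedral group G_{5,3,6}(2,0) is finite of order 14400
(60 times the number 240 of dodecahedra in Table 1). -/
theorem tessGroup_536_order :
    Finite (tessGroup 5 3 6 2 0) ∧ Nat.card (tessGroup 5 3 6 2 0) = 14400 :=
  ⟨Nat.finite_of_card_ne_zero (by rw [card_tessGroup_536]; norm_num), card_tessGroup_536⟩
end

section
/- For all integers a ≥ b ≥ 0 with a + b ≥ 6, the presented group G_{3,3,6}(a,b) = ⟨P, Q, R | P³, Q³, R⁶, (PQ)², (QR)², (PQR)², (QR⁴)^a (RQR³)^b⟩ is infinite. (This is the tetrahedral case of Theorem 7.1: the universal regular tessellation of type {3,3,6} and cusp modulus z = a+bζ is infinite volume when the combinatorial length ‖z‖ = a+b is at least 6.) -/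
namespace Systolic

variable {V : Type}

/-- Two vertices of a graph are near if they are equal or adjacent. -/
def Near (X : SimpleGraph V) (x y : V) : Prop := x = y ∨ X.Adj x y

/-- No vertex link of the graph contains an induced cycle of length four or five. -/
structure LocallySixLarge (X : SimpleGraph V) : Prop where
  four : ∀ p x₁ x₂ x₃ x₄ : V, X.Adj p x₁ → X.Adj p x₂ → X.Adj p x₃ → X.Adj p x₄ →
    X.Adj x₁ x₂ → X.Adj x₂ x₃ → X.Adj x₃ x₄ → X.Adj x₄ x₁ → Near X x₁ x₃ ∨ Near X x₂ x₄
  five : ∀ p x₁ x₂ x₃ x₄ x₅ : V, X.Adj p x₁ → X.Adj p x₂ → X.Adj p x₃ → X.Adj p x₄ →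
    X.Adj p x₅ → X.Adj x₁ x₂ → X.Adj x₂ x₃ → X.Adj x₃ x₄ → X.Adj x₄ x₅ → X.Adj x₅ x₁ →
    Near X x₁ x₃ ∨ Near X x₂ x₄ ∨ Near X x₃ x₅ ∨ Near X x₄ x₁ ∨ Near X x₅ x₂

lemma LocallySixLarge.near_of_adj_clique {X : SimpleGraph V} (hX : LocallySixLarge X)
    {p z a b : V} {D : V → Prop} (hD : ∀ d, D d → X.Adj d p)
    (hclique : ∀ d d', D d → D d' → Near X d d') (hzp : X.Adj z p) (hz : ¬ D z)
    (hzD : ∀ d, D d → ¬ X.Adj d z) (hap : X.Adj a p) (hbp : X.Adj b p)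
    (haz : X.Adj a z) (hbz : X.Adj b z)
    (ha : ∃ d, D d ∧ X.Adj d a) (hb : ∃ d, D d ∧ X.Adj d b) : Near X a b := by
  have key : ∀ d, D d → X.Adj d a → X.Adj d b → Near X a b := by
    intro d hd hda hdb
    rcases hX.four p z a d b hzp.symm hap.symm (hD d hd).symm hbp.symm haz.symm hda.symm hdb
      hbz with (rfl | h) | h
    · exact absurd hd hz
    · exact absurd h.symm (hzD d hd)
    · exact h
  obtain ⟨d, hd, hda⟩ := ha
  obtain ⟨e, he, heb⟩ := hb
  rcases hclique d e hd he with rfl | hde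
  · exact key d hd hda heb
  · rcases hX.five p z a d e b hzp.symm hap.symm (hD d hd).symm (hD e he).symm hbp.symm haz.symm
      hda.symm hde heb hbz with (rfl | h) | (rfl | h) | (rfl | h) | (rfl | h) | (rfl | h)
    · exact absurd hd hz
    · exact absurd h.symm (hzD d hd)
    · exact absurd haz (hzD _ he)
    · exact key e he h.symm heb
    · exact absurd hbz (hzD _ hd)
    · exact key d hd hda h
    · exact absurd he hz
    · exact absurd h (hzD _ he)
    · exact Or.inl rfl
    · exact Or.inr h.symm

/-- A sphere in the universal cover of the clique complex of `X`: its vertices, the covering map,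
adjacency within the sphere, and the directions that lead back to the previous sphere. -/
structure Layer (X : SimpleGraph V) where
  carrier : Type
  proj : carrier → V
  side : carrier → carrier → Prop
  down : carrier → V → Prop
  side_symm : ∀ {y y'}, side y y' → side y' y
  side_adj : ∀ {y y'}, side y y' → X.Adj (proj y) (proj y')
  side_unique : ∀ {y y₁ y₂}, side y y₁ → side y y₂ → proj y₁ = proj y₂ → y₁ = y₂
  side_triangle : ∀ {y y₁ y₂}, side y y₁ → side y y₂ → X.Adj (proj y₁) (proj y₂) → side y₁ y₂
  down_adj : ∀ {y x}, down y x → X.Adj x (proj y)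
  down_clique : ∀ {y x x'}, down y x → down y x' → Near X x x'
  not_down_side : ∀ {y y'}, side y y' → ¬ down y (proj y')
  side_iff : ∀ {y z}, X.Adj z (proj y) → ¬ down y z →
    ((∃ y', side y y' ∧ proj y' = z) ↔ ∃ d, down y d ∧ X.Adj d z)
  down_of_side : ∀ {y y' x}, side y y' → down y x → X.Adj x (proj y') → down y' x

namespace Layer

variable {X : SimpleGraph V}

/-- The directions leading to the next sphere. -/
def Up (S : Layer X) (y : S.carrier) (z : V) : Prop :=
  X.Adj z (S.proj y) ∧ ¬ S.down y z ∧ ∀ d, S.down y d → ¬ X.Adj d z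

lemma Up.not_side {S : Layer X} {y y' : S.carrier} {z : V} (h : S.Up y z) (e : S.proj y' = z) :
    ¬ S.side y y' := by
  intro hs
  subst e
  obtain ⟨d, hd, hdz⟩ := (S.side_iff h.1 h.2.1).1 ⟨y', hs, rfl⟩
  exact h.2.2 d hd hdz

lemma Up.of_side {S : Layer X} {y y' : S.carrier} {z : V} (h : S.Up y z) (hs : S.side y y')
    (hz : X.Adj z (S.proj y')) : S.Up y' z := by
  have hnd : ¬ S.down y' z := fun hd => h.2.1 (S.down_of_side (S.side_symm hs) hd h.1)
  refine ⟨hz, hnd, fun d hd hdz => ?_⟩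
  obtain ⟨w, hw, rfl⟩ := (S.side_iff hz hnd).2 ⟨d, hd, hdz⟩
  exact h.not_side rfl (S.side_triangle (S.side_symm hs) hw h.1.symm)

lemma Up.side_trans {S : Layer X} (hX : LocallySixLarge X) {y₁ y₂ y₃ : S.carrier} {z : V}
    (h₁ : S.Up y₁ z) (h₂ : S.Up y₂ z) (h₃ : S.Up y₃ z)
    (h₁₂ : S.side y₁ y₂) (h₂₃ : S.side y₂ y₃) : y₁ = y₃ ∨ S.side y₁ y₃ := by
  have h₂₁ := S.side_symm h₁₂
  have a₁ := S.side_adj h₁₂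
  have a₃ := (S.side_adj h₂₃).symm
  rcases hX.near_of_adj_clique (D := S.down y₂) (fun d hd => S.down_adj hd)
    (fun d d' hd hd' => S.down_clique hd hd') h₂.1 h₂.2.1 h₂.2.2 a₁ a₃ h₁.1.symm h₃.1.symm
    ((S.side_iff a₁ (S.not_down_side h₂₁)).1 ⟨_, h₂₁, rfl⟩)
    ((S.side_iff a₃ (S.not_down_side h₂₃)).1 ⟨_, h₂₃, rfl⟩) with h | h
  · exact Or.inl (S.side_unique h₂₁ h₂₃ h)
  · exact Or.inr (S.side_triangle h₂₁ h₂₃ h)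

/-- Outgoing directions at adjacent vertices with a common endpoint are identified. -/
def upSetoid (hX : LocallySixLarge X) (S : Layer X) :
    Setoid {q : S.carrier × V // S.Up q.1 q.2} where
  r q q' := q.1.2 = q'.1.2 ∧ (q.1.1 = q'.1.1 ∨ S.side q.1.1 q'.1.1)
  iseqv :=
    { refl := fun _ => ⟨rfl, Or.inl rfl⟩
      symm := fun h => ⟨h.1.symm, h.2.imp Eq.symm S.side_symm⟩
      trans := by
        rintro ⟨⟨y₁, z⟩, h₁⟩ ⟨⟨y₂, z₂⟩, h₂⟩ ⟨⟨y₃, z₃⟩, h₃⟩ ⟨e, h₁₂⟩ ⟨e', h₂₃⟩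
        dsimp only at *
        subst e e'
        refine ⟨rfl, ?_⟩
        rcases h₁₂ with rfl | h₁₂
        · exact h₂₃
        · rcases h₂₃ with rfl | h₂₃
          · exact Or.inr h₁₂
          · exact h₁.side_trans hX h₂ h₃ h₁₂ h₂₃ }

/-- The vertices of the next sphere. -/
def Next (hX : LocallySixLarge X) (S : Layer X) : Type := Quotient (S.upSetoid hX)

/-- The covering map on the next sphere. -/
def nextProj (hX : LocallySixLarge X) (S : Layer X) : S.Next hX → V :=
  Quotient.lift (fun q => q.1.2) fun _ _ h => h.1

/-- `S.Parent hX u y` says that `y` is a neighbour in `S` of the vertex `u` of the next sphere. -/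
def Parent (hX : LocallySixLarge X) (S : Layer X) (u : S.Next hX) (y : S.carrier) : Prop :=
  ∃ h : S.Up y (S.nextProj hX u), u = Quotient.mk (S.upSetoid hX) ⟨(y, S.nextProj hX u), h⟩

variable {hX : LocallySixLarge X} {S : Layer X}

lemma Parent.up {u : S.Next hX} {y : S.carrier} (h : S.Parent hX u y) :
    S.Up y (S.nextProj hX u) := h.1

lemma Parent.adj {u : S.Next hX} {y : S.carrier} (h : S.Parent hX u y) :
    X.Adj (S.nextProj hX u) (S.proj y) := h.up.1

lemma Up.exists_child (hX : LocallySixLarge X) {y : S.carrier} {z : V} (h : S.Up y z) :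
    ∃ u, S.Parent hX u y ∧ S.nextProj hX u = z :=
  ⟨Quotient.mk (S.upSetoid hX) ⟨(y, z), h⟩, ⟨h, rfl⟩, rfl⟩

lemma Parent.child_unique {u u' : S.Next hX} {y : S.carrier} (h : S.Parent hX u y)
    (h' : S.Parent hX u' y) (e : S.nextProj hX u = S.nextProj hX u') : u = u' := by
  obtain ⟨k, hk⟩ := h
  obtain ⟨k', hk'⟩ := h'
  rw [hk, hk']
  exact Quotient.sound ⟨e, Or.inl rfl⟩

lemma Parent.eq_or_side {u : S.Next hX} {y y' : S.carrier} (h : S.Parent hX u y)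
    (h' : S.Parent hX u y') : y = y' ∨ S.side y y' := by
  obtain ⟨k, hk⟩ := h
  obtain ⟨k', hk'⟩ := h'
  have := hk.symm.trans hk'
  exact (Quotient.exact this).2

lemma Parent.unique {u : S.Next hX} {y y' : S.carrier} (h : S.Parent hX u y)
    (h' : S.Parent hX u y') (e : S.proj y = S.proj y') : y = y' :=
  (h.eq_or_side h').resolve_right fun hs => (S.side_adj hs).ne e

lemma Parent.side {u : S.Next hX} {y y' : S.carrier} (h : S.Parent hX u y)
    (h' : S.Parent hX u y') (e : X.Adj (S.proj y) (S.proj y')) : S.side y y' :=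
  (h.eq_or_side h').resolve_left fun hs => e.ne (congrArg _ hs)

lemma Parent.of_side {u : S.Next hX} {y y' : S.carrier} (h : S.Parent hX u y)
    (hs : S.side y y') (e : X.Adj (S.nextProj hX u) (S.proj y')) : S.Parent hX u y' := by
  have hu := h.up.of_side hs e
  refine ⟨hu, ?_⟩
  obtain ⟨k, hk⟩ := h
  exact hk.trans (Quotient.sound ⟨rfl, Or.inr hs⟩)

/-- Adjacency within the next sphere. -/
def nextSide (hX : LocallySixLarge X) (S : Layer X) (u u' : S.Next hX) : Prop :=
  X.Adj (S.nextProj hX u) (S.nextProj hX u') ∧ ∃ y, S.Parent hX u y ∧ S.Parent hX u' y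

lemma Parent.of_nextSide {u u' : S.Next hX} {y : S.carrier} (h : S.Parent hX u y)
    (hs : S.nextSide hX u u') (e : X.Adj (S.proj y) (S.nextProj hX u')) : S.Parent hX u' y := by
  obtain ⟨-, w, hw, hw'⟩ := hs
  rcases hw.eq_or_side h with rfl | hwy
  · exact hw'
  · exact hw'.of_side hwy e.symm

/-- The sphere following a given one. -/
def next (hX : LocallySixLarge X) (S : Layer X) : Layer X where
  carrier := S.Next hX
  proj := S.nextProj hX
  side := S.nextSide hX
  down u x := ∃ y, S.Parent hX u y ∧ S.proj y = x
  side_symm := fun ⟨h, y, hy, hy'⟩ => ⟨h.symm, y, hy', hy⟩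
  side_adj h := h.1
  side_unique := by
    rintro u u₁ u₂ ⟨a₁, y₁, h₁, k₁⟩ ⟨-, y₂, h₂, k₂⟩ e
    rcases h₁.eq_or_side h₂ with rfl | hs
    · exact k₁.child_unique k₂ e
    · exact (k₁.of_side hs (e ▸ k₂.adj)).child_unique k₂ e
  side_triangle := by
    rintro u u₁ u₂ ⟨a₁, y₁, h₁, k₁⟩ ⟨a₂, y₂, h₂, k₂⟩ a
    refine ⟨a, ?_⟩
    rcases h₁.eq_or_side h₂ with rfl | hs
    · exact ⟨y₁, k₁, k₂⟩
    · rcases hX.four (S.nextProj hX u) (S.proj y₁) (S.proj y₂) (S.nextProj hX u₂)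
        (S.nextProj hX u₁) h₁.adj h₂.adj a₂ a₁ (S.side_adj hs) k₂.adj.symm a.symm k₁.adj with
        (e | e) | (e | e)
      · exact absurd (S.side_symm hs) (k₂.up.not_side e)
      · exact ⟨y₁, k₁, k₂.of_side (S.side_symm hs) e.symm⟩
      · exact absurd hs (k₁.up.not_side e)
      · exact ⟨y₂, k₁.of_side hs e.symm, k₂⟩
  down_adj := by
    rintro u x ⟨y, h, rfl⟩
    exact h.adj.symm
  down_clique := by
    rintro u x x' ⟨y, h, rfl⟩ ⟨y', h', rfl⟩
    rcases h.eq_or_side h' with rfl | hs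
    · exact Or.inl rfl
    · exact Or.inr (S.side_adj hs)
  not_down_side := by
    rintro u u' ⟨a, y, h, h'⟩ ⟨w, hw, e⟩
    rcases h.eq_or_side hw with rfl | hs
    · exact h'.adj.ne e.symm
    · exact h'.up.not_side e hs
  side_iff := by
    intro u z a hz
    constructor
    · rintro ⟨u', ⟨-, y, h, h'⟩, rfl⟩
      exact ⟨_, ⟨y, h, rfl⟩, h'.adj.symm⟩
    · rintro ⟨_, ⟨y, h, rfl⟩, e⟩
      have hdown : ¬ S.down y z := fun hd => h.up.2.2 z hd a
      have hup : S.Up y z := by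
        refine ⟨e.symm, hdown, fun d hd hdz => ?_⟩
        obtain ⟨w, hw, rfl⟩ := (S.side_iff e.symm hdown).2 ⟨d, hd, hdz⟩
        exact hz ⟨w, h.of_side hw a.symm, rfl⟩
      obtain ⟨u', h', rfl⟩ := hup.exists_child hX
      exact ⟨u', ⟨a.symm, y, h, h'⟩, rfl⟩
  down_of_side := by
    rintro u u' x hs ⟨y, h, rfl⟩ e
    exact ⟨y, h.of_nextSide hs e, rfl⟩

/-- The sphere of radius zero. -/
def base (X : SimpleGraph V) (v : V) : Layer X where
  carrier := Unit
  proj _ := v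
  side _ _ := False
  down _ _ := False
  side_symm := by simp
  side_adj := by simp
  side_unique := by simp
  side_triangle := by simp
  down_adj := by simp
  down_clique := by simp
  not_down_side := by simp
  side_iff := by simp
  down_of_side := by simp

/-- The sphere of radius `n` about a lift of `v`. -/
def sphere (hX : LocallySixLarge X) (v : V) : ℕ → Layer X
  | 0 => base X v
  | n + 1 => (sphere hX v n).next hX

end Layer

open Layer

variable {X : SimpleGraph V}

/-- The vertices of the universal cover, graded by distance from a lift of `v`. -/
def Cover (hX : LocallySixLarge X) (v : V) : Type := Σ n, (sphere hX v n).carrier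

namespace Cover

variable {hX : LocallySixLarge X} {v : V}

/-- The covering map. -/
def proj (y : Cover hX v) : V := (sphere hX v y.1).proj y.2

/-- Adjacency in the universal cover. -/
inductive Adj : Cover hX v → Cover hX v → Prop
  | side {n : ℕ} {y y' : (sphere hX v n).carrier} (h : (sphere hX v n).side y y') :
      Adj ⟨n, y⟩ ⟨n, y'⟩
  | up {n : ℕ} {y : (sphere hX v n).carrier} {u : (sphere hX v n).Next hX}
      (h : (sphere hX v n).Parent hX u y) : Adj ⟨n, y⟩ ⟨n + 1, u⟩
  | down {n : ℕ} {y : (sphere hX v n).carrier} {u : (sphere hX v n).Next hX}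
      (h : (sphere hX v n).Parent hX u y) : Adj ⟨n + 1, u⟩ ⟨n, y⟩

lemma Adj.symm {y y' : Cover hX v} (h : Adj y y') : Adj y' y := by
  cases h with
  | side h => exact .side (Layer.side_symm _ h)
  | up h => exact .down h
  | down h => exact .up h

lemma Adj.proj {y y' : Cover hX v} (h : Adj y y') : X.Adj y.proj y'.proj := by
  cases h with
  | side h => exact Layer.side_adj _ h
  | up h => exact h.adj.symm
  | down h => exact h.adj

lemma exists_lift (y : Cover hX v) {x : V} (hx : X.Adj y.proj x) :
    ∃ y', Adj y y' ∧ y'.proj = x := by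
  obtain ⟨n, y⟩ := y
  by_cases hd : (sphere hX v n).down y x
  · cases n with
    | zero => exact hd.elim
    | succ n =>
      obtain ⟨w, hw, rfl⟩ := hd
      exact ⟨⟨n, w⟩, .down hw, rfl⟩
  · by_cases hs : ∃ d, (sphere hX v n).down y d ∧ X.Adj d x
    · obtain ⟨w, hw, rfl⟩ := ((sphere hX v n).side_iff hx.symm hd).2 hs
      exact ⟨⟨n, w⟩, .side hw, rfl⟩
    · have hu : (sphere hX v n).Up y x := ⟨hx.symm, hd, fun d hd' e => hs ⟨d, hd', e⟩⟩
      obtain ⟨u, h, rfl⟩ := hu.exists_child hX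
      exact ⟨⟨n + 1, u⟩, .up h, rfl⟩

lemma Adj.unique {y y₁ y₂ : Cover hX v} (h₁ : Adj y y₁) (h₂ : Adj y y₂)
    (e : y₁.proj = y₂.proj) : y₁ = y₂ := by
  cases h₁ with
  | side h₁ =>
    cases h₂ with
    | side h₂ => exact congrArg _ (Layer.side_unique _ h₁ h₂ e)
    | up h₂ => exact absurd h₁ (h₂.up.not_side e)
    | down h₂ => exact absurd ⟨_, h₂, e.symm⟩ (Layer.not_down_side _ h₁)
  | up h₁ =>
    cases h₂ with
    | side h₂ => exact absurd h₂ (h₁.up.not_side e.symm)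
    | up h₂ => exact congrArg _ (h₁.child_unique h₂ e)
    | down h₂ => exact absurd ⟨_, h₂, e.symm⟩ h₁.up.2.1
  | down h₁ =>
    cases h₂ with
    | side h₂ => exact absurd ⟨_, h₁, e⟩ (Layer.not_down_side _ h₂)
    | up h₂ => exact absurd ⟨_, h₁, e⟩ h₂.up.2.1
    | down h₂ => exact congrArg _ (h₁.unique h₂ e)

lemma Adj.triangle {y y₁ y₂ : Cover hX v} (h₁ : Adj y y₁) (h₂ : Adj y y₂)
    (e : X.Adj y₁.proj y₂.proj) : Adj y₁ y₂ := by
  cases h₁ with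
  | side h₁ =>
    cases h₂ with
    | side h₂ => exact .side (Layer.side_triangle _ h₁ h₂ e)
    | up h₂ => exact .up (h₂.of_side h₁ e.symm)
    | down h₂ => exact .down (h₂.of_nextSide h₁ e.symm)
  | up h₁ =>
    cases h₂ with
    | side h₂ => exact .down (h₁.of_side h₂ e)
    | up h₂ => exact .side ⟨e, _, h₁, h₂⟩
    | down h₂ => exact absurd e.symm (h₁.up.2.2 _ ⟨_, h₂, rfl⟩)
  | down h₁ =>
    cases h₂ with
    | side h₂ => exact .up (h₁.of_nextSide h₂ e)
    | up h₂ => exact absurd e (h₂.up.2.2 _ ⟨_, h₁, rfl⟩)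
    | down h₂ => exact .side (h₁.side h₂ e)

end Cover

/-- A vertex of the universal cover, together with an automorphism of the base moving its
projection to `v`. -/
def Flag (hX : LocallySixLarge X) (v : V) : Type :=
  {t : Cover hX v × (X ≃g X) // t.1.proj = t.2⁻¹ v}

namespace Flag

variable {hX : LocallySixLarge X} {v : V}

@[ext]
lemma ext {t t' : Flag hX v} (h₁ : t.1.1 = t'.1.1) (h₂ : t.1.2 = t'.1.2) : t = t' :=
  Subtype.ext (Prod.ext h₁ h₂)

/-- The stabilizer of `v` acts on the flags at each vertex of the universal cover. -/
def rotate (hX : LocallySixLarge X) (v : V) :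
    MulAction.stabilizer (X ≃g X) v →* Equiv.Perm (Flag hX v) :=
  letI : MulAction (MulAction.stabilizer (X ≃g X) v) (Flag hX v) :=
    { smul b t := ⟨(t.1.1, b.1 * t.1.2), by
        have hb : (b⁻¹).1 • v = v := (b⁻¹).2
        have e : (b.1 * t.1.2)⁻¹ v = t.1.2⁻¹ ((b⁻¹).1 • v) := by rw [mul_inv_rev]; rfl
        rw [e, hb]
        exact t.2⟩
      one_smul t := ext rfl (one_mul _)
      mul_smul b c t := ext rfl (mul_assoc _ _ _) }
  MulAction.toPermHom _ _

@[simp]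
lemma rotate_frame (b : MulAction.stabilizer (X ≃g X) v) (t : Flag hX v) :
    (rotate hX v b t).1.2 = b.1 * t.1.2 := rfl

variable {s : X ≃g X}

lemma exists_flip (hs : X.Adj v (s⁻¹ v)) (t : Flag hX v) :
    ∃ t' : Flag hX v, Cover.Adj t.1.1 t'.1.1 ∧ t'.1.2 = s * t.1.2 := by
  have h : X.Adj t.1.1.proj ((s * t.1.2)⁻¹ v) := by
    rw [t.2, mul_inv_rev]
    exact t.1.2⁻¹.map_rel_iff.2 hs
  obtain ⟨y, hy, e⟩ := Cover.exists_lift _ h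
  exact ⟨⟨(y, s * t.1.2), e⟩, hy, rfl⟩

lemma eq_of_adj {y : Cover hX v} {t t' : Flag hX v} (h : Cover.Adj y t.1.1)
    (h' : Cover.Adj y t'.1.1) (e : t.1.2 = t'.1.2) : t = t' :=
  ext (h.unique h' (by rw [t.2, t'.2, e])) e

/-- Crossing to the neighbouring vertex in the direction prescribed by the involution `s`. -/
noncomputable def flip (hX : LocallySixLarge X) (hs : X.Adj v (s⁻¹ v)) (hs₂ : s * s = 1) :
    Equiv.Perm (Flag hX v) :=
  Function.Involutive.toPerm (fun t => (exists_flip hs t).choose) fun t =>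
    eq_of_adj (exists_flip hs (exists_flip hs t).choose).choose_spec.1
      (exists_flip hs t).choose_spec.1.symm (by
        rw [(exists_flip hs (exists_flip hs t).choose).choose_spec.2,
          (exists_flip hs t).choose_spec.2, ← mul_assoc, hs₂, one_mul])

variable (hs : X.Adj v (s⁻¹ v)) (hs₂ : s * s = 1)

lemma adj_flip (t : Flag hX v) : Cover.Adj t.1.1 (flip hX hs hs₂ t).1.1 :=
  (exists_flip hs t).choose_spec.1

lemma flip_frame (t : Flag hX v) : (flip hX hs hs₂ t).1.2 = s * t.1.2 :=
  (exists_flip hs t).choose_spec.2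

lemma flip_sq : flip hX hs hs₂ ^ 2 = 1 := by
  ext1 t
  rw [pow_two]
  exact eq_of_adj (adj_flip hs hs₂ _) (adj_flip hs hs₂ t).symm
    (by simp [flip_frame, ← mul_assoc, hs₂])

lemma flip_mul_rotate_sq (b : MulAction.stabilizer (X ≃g X) v) (h : (s * b.1) ^ 2 = 1) :
    (flip hX hs hs₂ * rotate hX v b) ^ 2 = 1 := by
  ext1 t
  rw [pow_two]
  refine eq_of_adj (adj_flip hs hs₂ _) (adj_flip hs hs₂ (rotate hX v b t)).symm ?_
  simpa [flip_frame, pow_two, mul_assoc] using congrArg (· * t.1.2) h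

lemma flip_mul_rotate_cube (b : MulAction.stabilizer (X ≃g X) v) (h : (s * b.1) ^ 3 = 1) :
    (flip hX hs hs₂ * rotate hX v b) ^ 3 = 1 := by
  ext1 t
  set m := flip hX hs hs₂ * rotate hX v b with hm
  have adj : ∀ t : Flag hX v, Cover.Adj t.1.1 (m t).1.1 := fun t =>
    adj_flip hs hs₂ (rotate hX v b t)
  have frame : ∀ t : Flag hX v, (m t).1.2 = s * b.1 * t.1.2 := fun t => by
    simp [hm, flip_frame, mul_assoc]
  have e : (m (m (m t))).1.2 = t.1.2 := by
    simpa [frame, pow_succ, mul_assoc] using congrArg (· * t.1.2) h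
  have e' : (m (m (m t))).1.1.proj = t.1.1.proj := by rw [(m (m (m t))).2, e, t.2]
  have a : Cover.Adj (m (m t)).1.1 t.1.1 := by
    refine (adj (m t)).triangle (adj t).symm ?_
    rw [← e']
    exact (adj (m (m t))).proj
  exact eq_of_adj (adj (m (m t))) a e

end Flag

/-- A systolic complex whose vertices see a full link has points at arbitrary distance, so a
tessellation group acting on it through flags is infinite. -/
theorem infinite_tessGroup (hX : LocallySixLarge X)
    (far : ∀ p d, X.Adj d p → ∃ z, X.Adj z p ∧
      ∀ d', X.Adj d' p → Near X d d' → d' ≠ z ∧ ¬ X.Adj d' z)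
    {v : V} (q r : MulAction.stabilizer (X ≃g X) v) (s : X ≃g X) (hs : X.Adj v (s v))
    (trans : ∀ x, X.Adj v x → ∃ m n : ℤ, ((q * r ^ 4) ^ m * (r * q * r ^ 3) ^ n).1 (s v) = x)
    (hs₂ : s * s = 1) (hq : q ^ 3 = 1) (hr : r ^ 6 = 1) (hqr : (q * r) ^ 2 = 1)
    (hsr : (s * r.1) ^ 2 = 1) (hsq : (s * q⁻¹.1) ^ 3 = 1) {a b : ℕ}
    (hab : (q * r ^ 4) ^ a * (r * q * r ^ 3) ^ b = 1) :
    Infinite (tessGroup 3 3 6 a b) := by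
  have hs' : X.Adj v (s⁻¹ v) := by rwa [inv_eq_of_mul_eq_one_left hs₂]
  let ρ := Flag.rotate hX v
  let σ := Flag.flip hX hs' hs₂
  let f : Fin 3 → Equiv.Perm (Flag hX v) := ![σ * ρ q⁻¹, ρ q, ρ r]
  have hq' : ρ q ^ 3 = 1 := by rw [← map_pow, hq, map_one]
  have hr' : ρ r ^ 6 = 1 := by rw [← map_pow, hr, map_one]
  have hqr' : (ρ q * ρ r) ^ 2 = 1 := by rw [← map_mul, ← map_pow, hqr, map_one]
  have hf : ∀ w ∈ tessRels 3 3 6 a b, FreeGroup.lift f w = 1 := by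
    rintro w (rfl | rfl | rfl | rfl | rfl | rfl | rfl)
    · simpa [f] using Flag.flip_mul_rotate_cube hs' hs₂ q⁻¹ hsq
    · simpa [f] using hq'
    · simpa [f] using hr'
    · simpa [f] using Flag.flip_sq hs' hs₂
    · simpa [f] using hqr'
    · simpa [f] using Flag.flip_mul_rotate_sq hs' hs₂ r hsr
    · simp only [f, map_mul, map_pow, FreeGroup.lift_apply_of]
      simp only [Matrix.cons_val, ← map_mul, ← map_pow]
      rw [show 6 / 2 + 1 = 4 from rfl, show 6 / 2 = 3 from rfl, hab, map_one]
  let Φ : tessGroup 3 3 6 a b →* Equiv.Perm (Flag hX v) := PresentedGroup.toGroup hf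
  let P : tessGroup 3 3 6 a b := PresentedGroup.of 0
  let Q : tessGroup 3 3 6 a b := PresentedGroup.of 1
  let R : tessGroup 3 3 6 a b := PresentedGroup.of 2
  have hP : Φ P = σ * ρ q⁻¹ := PresentedGroup.toGroup.of hf
  have hQ : Φ Q = ρ q := PresentedGroup.toGroup.of hf
  have hR : Φ R = ρ r := PresentedGroup.toGroup.of hf
  let t₀ : Flag hX v := ⟨(⟨0, ()⟩, 1), rfl⟩
  have step : ∀ n, ∃ g, (Φ g t₀).1.1.1 = n := by
    intro n
    induction n with
    | zero => exact ⟨1, by rw [map_one]; rfl⟩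
    | succ n ih =>
      obtain ⟨g, hg⟩ := ih
      rcases ht : Φ g t₀ with ⟨⟨⟨m, y⟩, k⟩, hk⟩
      obtain rfl : m = n := by rw [ht] at hg; exact hg
      have hup : ∃ z, (Layer.sphere hX v m).Up y z := by
        by_cases hD : ∃ d, (Layer.sphere hX v m).down y d
        · obtain ⟨d, hd⟩ := hD
          obtain ⟨z, hz, hz'⟩ := far _ d (Layer.down_adj _ hd)
          have hz'' := fun e he => hz' e (Layer.down_adj _ he) (Layer.down_clique _ hd he)
          exact ⟨z, hz, fun h => (hz'' z h).1 rfl, fun e he => (hz'' e he).2⟩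
        · push Not at hD
          refine ⟨k⁻¹ (s v), ?_, hD _, fun d hd => absurd hd (hD d)⟩
          have e : (Layer.sphere hX v m).proj y = k⁻¹ v := hk
          rw [e]
          exact k⁻¹.map_rel_iff.2 hs.symm
      obtain ⟨z, hz⟩ := hup
      obtain ⟨u, hu, rfl⟩ := hz.exists_child hX
      have hkz : X.Adj v (k (Layer.nextProj hX _ u)) := by
        have h := k.map_rel_iff.2 hu.adj.symm
        have e : (Layer.sphere hX v m).proj y = k⁻¹ v := hk
        rwa [e, RelIso.apply_inv_self] at h
      obtain ⟨i, j, hij⟩ := trans _ hkz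
      set c := (q * r ^ 4) ^ i * (r * q * r ^ 3) ^ j with hc
      let C := (Q * R ^ 4) ^ i * (R * Q * R ^ 3) ^ j
      have hC : Φ C = ρ c := by simp [C, hc, hQ, hR]
      refine ⟨P * Q * C⁻¹ * g, ?_⟩
      have e₁ : Φ (P * Q * C⁻¹ * g) t₀ = σ (ρ c⁻¹ (Φ g t₀)) := by
        simp only [map_mul, map_inv, hC, hP, hQ]
        simp
      rw [e₁, ht]
      set t' := σ (ρ c⁻¹ ⟨(⟨m, y⟩, k), hk⟩) with ht'
      have a₁ : Cover.Adj (⟨m, y⟩ : Cover hX v) t'.1.1 :=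
        Flag.adj_flip hs' hs₂ (ρ c⁻¹ ⟨(⟨m, y⟩, k), hk⟩)
      have a₂ : Cover.Adj (⟨m, y⟩ : Cover hX v) ⟨m + 1, u⟩ := .up hu
      have e₂ : t'.1.1.proj = Cover.proj ⟨m + 1, u⟩ := by
        have e₃ : t'.1.2 = s * (c⁻¹.1 * k) := Flag.flip_frame hs' hs₂ _
        rw [t'.2, e₃, mul_inv_rev, mul_inv_rev, inv_eq_of_mul_eq_one_left hs₂]
        change k⁻¹ ((c⁻¹.1)⁻¹ (s v)) = _
        rw [Subgroup.coe_inv, inv_inv, hij]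
        exact RelIso.inv_apply_self _ _
      rw [a₁.unique a₂ e₂]
  choose g hg using step
  exact Infinite.of_injective g fun m n h => by rw [← hg m, ← hg n, h]

/-- A quotient of the ring of Eisenstein integers, with `ζ` the image of a primitive sixth root of
unity, in which no nonzero element of combinatorial length at most five vanishes. -/
structure IsHexagonal {S : Type} [CommRing S] (ζ : S) : Prop where
  sq : ζ ^ 2 = ζ - 1
  span : ∀ x : S, ∃ m n : ℤ, x = m + n * ζ
  short : ∀ m n : ℤ, |m| ≤ 5 → |n| ≤ 5 → |m + n| ≤ 5 → (m + n * ζ : S) = 0 → m = 0 ∧ n = 0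

/-- The sixth roots of unity in the hexagonal lattice, followed by zero. -/
def hexVec : Fin 7 → ℤ × ℤ := ![(1, 0), (0, 1), (-1, 1), (-1, 0), (0, -1), (1, -1), (0, 0)]

lemma abs_hexVec : ∀ i, |(hexVec i).1| ≤ 1 ∧ |(hexVec i).2| ≤ 1 ∧
    |(hexVec i).1 + (hexVec i).2| ≤ 1 := by
  decide

lemma hexVec_quadrangle : ∀ i j k l : Fin 7, hexVec i + hexVec j + hexVec k + hexVec l = 0 →
    (∃ n, hexVec i + hexVec j = hexVec n) ∨ ∃ n, hexVec j + hexVec k = hexVec n := by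
  decide +kernel

lemma hexVec_pentagon : ∀ i j k l m : Fin 7,
    hexVec i + hexVec j + hexVec k + hexVec l + hexVec m = 0 →
    (∃ n, hexVec i + hexVec j = hexVec n) ∨ (∃ n, hexVec j + hexVec k = hexVec n) ∨
      ∃ n, hexVec k + hexVec l = hexVec n := by
  decide +kernel

lemma three_add_hexVec : ∀ i j : Fin 7, (3, 0) + hexVec i - hexVec j ≠ 0 := by
  decide

section Hexagonal

variable {S : Type} [CommRing S] {ζ : S}

/-- The image of a point of the hexagonal lattice. -/
def latticeMap (ζ : S) : ℤ × ℤ →+ S where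
  toFun x := x.1 + x.2 * ζ
  map_zero' := by simp
  map_add' x y := by push_cast [Prod.fst_add, Prod.snd_add]; ring

/-- The element is zero or a power of `ζ`. -/
def IsSmall (ζ x : S) : Prop := x = 0 ∨ ∃ k : ℕ, x = ζ ^ k

namespace IsHexagonal

lemma pow_six (h : IsHexagonal ζ) : ζ ^ 6 = 1 := by
  linear_combination (ζ ^ 4 + ζ ^ 3 - ζ - 1) * h.sq

lemma pow_mul_pow (h : IsHexagonal ζ) (k : ℕ) : ζ ^ (5 * k) * ζ ^ k = 1 := by
  rw [← pow_add, show 5 * k + k = 6 * k by ring, pow_mul, h.pow_six, one_pow]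

lemma isSmall_iff (h : IsHexagonal ζ) {x : S} :
    IsSmall ζ x ↔ ∃ i, x = latticeMap ζ (hexVec i) := by
  have h₀ : latticeMap ζ (hexVec 0) = ζ ^ 0 := by simp [latticeMap, hexVec]
  have h₁ : latticeMap ζ (hexVec 1) = ζ ^ 1 := by simp [latticeMap, hexVec]
  have h₂ : latticeMap ζ (hexVec 2) = ζ ^ 2 := by
    simp [latticeMap, hexVec]; linear_combination -h.sq
  have h₃ : latticeMap ζ (hexVec 3) = ζ ^ 3 := by
    simp [latticeMap, hexVec]; linear_combination (-ζ - 1) * h.sq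
  have h₄ : latticeMap ζ (hexVec 4) = ζ ^ 4 := by
    simp [latticeMap, hexVec]; linear_combination (-ζ ^ 2 - ζ) * h.sq
  have h₅ : latticeMap ζ (hexVec 5) = ζ ^ 5 := by
    simp [latticeMap, hexVec]; linear_combination (-ζ ^ 3 - ζ ^ 2 + 1) * h.sq
  have h₆ : latticeMap ζ (hexVec 6) = 0 := map_zero _
  constructor
  · rintro (rfl | ⟨k, rfl⟩)
    · exact ⟨6, h₆.symm⟩
    · rw [← Nat.div_add_mod k 6, pow_add, pow_mul, h.pow_six, one_pow, one_mul]
      have := Nat.mod_lt k (by norm_num : 6 > 0)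
      interval_cases k % 6
      exacts [⟨0, h₀.symm⟩, ⟨1, h₁.symm⟩, ⟨2, h₂.symm⟩, ⟨3, h₃.symm⟩, ⟨4, h₄.symm⟩, ⟨5, h₅.symm⟩]
  · rintro ⟨i, rfl⟩
    fin_cases i
    exacts [.inr ⟨0, h₀⟩, .inr ⟨1, h₁⟩, .inr ⟨2, h₂⟩, .inr ⟨3, h₃⟩, .inr ⟨4, h₄⟩, .inr ⟨5, h₅⟩,
      .inl h₆]

lemma eq_zero_of_latticeMap (h : IsHexagonal ζ) {x : ℤ × ℤ} (h₁ : |x.1| ≤ 5) (h₂ : |x.2| ≤ 5)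
    (h₁₂ : |x.1 + x.2| ≤ 5) (hx : latticeMap ζ x = 0) : x = 0 :=
  Prod.ext_iff.2 (h.short x.1 x.2 h₁ h₂ h₁₂ hx)

lemma quadrangle (h : IsHexagonal ζ) {w x y z : S} (hw : IsSmall ζ w) (hx : IsSmall ζ x)
    (hy : IsSmall ζ y) (hz : IsSmall ζ z) (hs : w + x + y + z = 0) :
    IsSmall ζ (w + x) ∨ IsSmall ζ (x + y) := by
  simp only [h.isSmall_iff] at *
  obtain ⟨i, rfl⟩ := hw
  obtain ⟨j, rfl⟩ := hx
  obtain ⟨k, rfl⟩ := hy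
  obtain ⟨l, rfl⟩ := hz
  simp only [← map_add] at *
  have bi := abs_hexVec i
  have bj := abs_hexVec j
  have bk := abs_hexVec k
  have bl := abs_hexVec l
  simp only [abs_le] at bi bj bk bl
  have := h.eq_zero_of_latticeMap (by simp only [Prod.fst_add, abs_le]; omega)
    (by simp only [Prod.snd_add, abs_le]; omega)
    (by simp only [Prod.fst_add, Prod.snd_add, abs_le]; omega) hs
  exact (hexVec_quadrangle i j k l this).imp (fun ⟨n, hn⟩ => ⟨n, by rw [hn]⟩)
    fun ⟨n, hn⟩ => ⟨n, by rw [hn]⟩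

lemma pentagon (h : IsHexagonal ζ) {v w x y z : S} (hv : IsSmall ζ v) (hw : IsSmall ζ w)
    (hx : IsSmall ζ x) (hy : IsSmall ζ y) (hz : IsSmall ζ z) (hs : v + w + x + y + z = 0) :
    IsSmall ζ (v + w) ∨ IsSmall ζ (w + x) ∨ IsSmall ζ (x + y) := by
  simp only [h.isSmall_iff] at *
  obtain ⟨i, rfl⟩ := hv
  obtain ⟨j, rfl⟩ := hw
  obtain ⟨k, rfl⟩ := hx
  obtain ⟨l, rfl⟩ := hy
  obtain ⟨m, rfl⟩ := hz
  simp only [← map_add] at *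
  have bi := abs_hexVec i
  have bj := abs_hexVec j
  have bk := abs_hexVec k
  have bl := abs_hexVec l
  have bm := abs_hexVec m
  simp only [abs_le] at bi bj bk bl bm
  have := h.eq_zero_of_latticeMap (by simp only [Prod.fst_add, abs_le]; omega)
    (by simp only [Prod.snd_add, abs_le]; omega)
    (by simp only [Prod.fst_add, Prod.snd_add, abs_le]; omega) hs
  exact (hexVec_pentagon i j k l m this).imp (fun ⟨n, hn⟩ => ⟨n, by rw [hn]⟩)
    (Or.imp (fun ⟨n, hn⟩ => ⟨n, by rw [hn]⟩) fun ⟨n, hn⟩ => ⟨n, by rw [hn]⟩)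

lemma not_isSmall_three_add (h : IsHexagonal ζ) {x : S} (hx : IsSmall ζ x) :
    ¬ IsSmall ζ (3 + x) := by
  intro hy
  rw [h.isSmall_iff] at hx hy
  obtain ⟨i, rfl⟩ := hx
  obtain ⟨j, hj⟩ := hy
  have bi := abs_hexVec i
  have bj := abs_hexVec j
  simp only [abs_le] at bi bj
  refine three_add_hexVec i j (h.eq_zero_of_latticeMap
    (by simp only [Prod.fst_add, Prod.fst_sub, abs_le]; omega)
    (by simp only [Prod.snd_add, Prod.snd_sub, abs_le]; omega)
    (by simp only [Prod.fst_add, Prod.snd_add, Prod.fst_sub, Prod.snd_sub, abs_le]; omega) ?_)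
  rw [map_sub, map_add, ← hj]
  simp [latticeMap]

lemma one_ne_zero (h : IsHexagonal ζ) : (1 : S) ≠ 0 := by
  intro h₁
  have := h.short 1 0 (by norm_num) (by norm_num) (by norm_num) (by simpa using h₁)
  exact absurd this.1 (by norm_num)

end IsHexagonal

/-- The determinant of a pair of vectors. -/
def cross (v w : S × S) : S := v.1 * w.2 - v.2 * w.1

lemma cross_add_cross {p u v w : S × S} (hu : cross p u = 1) (hv : cross p v = 1)
    (hw : cross p w = 1) : cross u v + cross v w = cross u w := by
  simp only [cross] at *
  linear_combination (-u.1 * v.2 + u.2 * v.1) * hw + (u.1 * w.2 - u.2 * w.1) * hv +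
    (-v.1 * w.2 + v.2 * w.1) * hu

lemma eq_of_cross_eq_zero {p v w : S × S} (hv : cross p v = 1) (hw : cross p w = 1)
    (h : cross v w = 0) : v = w := by
  simp only [cross] at *
  ext
  · linear_combination p.1 * h - v.1 * hw + w.1 * hv
  · linear_combination p.2 * h - v.2 * hw + w.2 * hv

/-- Vectors up to multiplication by powers of `ζ`. -/
def projSetoid (h : IsHexagonal ζ) : Setoid (S × S) where
  r v w := ∃ k : ℕ, w = ζ ^ k • v
  iseqv :=
    { refl := fun v => ⟨0, by simp⟩
      symm := by
        rintro v _ ⟨k, rfl⟩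
        exact ⟨5 * k, by rw [smul_smul, h.pow_mul_pow, one_smul]⟩
      trans := by
        rintro v _ _ ⟨k, rfl⟩ ⟨l, rfl⟩
        exact ⟨l + k, by rw [smul_smul, pow_add]⟩ }

/-- The vertices of the congruence tessellation. -/
def Cusp (h : IsHexagonal ζ) : Type := Quotient (projSetoid h)

/-- The vertex determined by a vector. -/
def toCusp (h : IsHexagonal ζ) (v : S × S) : Cusp h := Quotient.mk (projSetoid h) v

variable {h : IsHexagonal ζ}

lemma toCusp_eq_iff {v w : S × S} : toCusp h v = toCusp h w ↔ ∃ k : ℕ, w = ζ ^ k • v :=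
  Quotient.eq (r := projSetoid h)

lemma toCusp_surjective (x : Cusp h) : ∃ v, toCusp h v = x := Quotient.exists_rep x

lemma cross_smul_smul (c d : S) (v w : S × S) : cross (c • v) (d • w) = c * d * cross v w := by
  simp only [cross, Prod.smul_fst, Prod.smul_snd, smul_eq_mul]
  ring

/-- The one-skeleton of the congruence tessellation: vertices are adjacent when their determinant
is a power of `ζ`. -/
def cuspGraph (h : IsHexagonal ζ) : SimpleGraph (Cusp h) where
  Adj x y := ∃ v w, toCusp h v = x ∧ toCusp h w = y ∧ ∃ k : ℕ, cross v w = ζ ^ k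
  symm := ⟨by
    rintro x y ⟨v, w, hv, hw, k, hk⟩
    refine ⟨w, v, hw, hv, k + 3, ?_⟩
    rw [pow_add, ← hk]
    simp only [cross]
    linear_combination (-v.1 * w.2 + v.2 * w.1) * (ζ + 1) * h.sq⟩
  loopless := ⟨by
    rintro x ⟨v, w, rfl, hw, k, hk⟩
    obtain ⟨l, rfl⟩ := toCusp_eq_iff.1 hw.symm
    have hz : ζ ^ k = 0 := by
      rw [← hk]
      simp only [cross, Prod.smul_fst, Prod.smul_snd, smul_eq_mul]
      ring
    have := h.pow_mul_pow k
    rw [hz, mul_zero] at this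
    exact h.one_ne_zero this.symm⟩

lemma cuspGraph_adj {v w : S × S} :
    (cuspGraph h).Adj (toCusp h v) (toCusp h w) ↔ ∃ k : ℕ, cross v w = ζ ^ k := by
  constructor
  · rintro ⟨v', w', hv, hw, k, hk⟩
    obtain ⟨i, rfl⟩ := toCusp_eq_iff.1 hv
    obtain ⟨j, rfl⟩ := toCusp_eq_iff.1 hw
    exact ⟨i + j + k, by rw [cross_smul_smul, hk, pow_add, pow_add]⟩
  · rintro ⟨k, hk⟩
    exact ⟨v, w, rfl, rfl, k, hk⟩

lemma exists_rep_of_adj {p : S × S} {x : Cusp h} (hx : (cuspGraph h).Adj (toCusp h p) x) :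
    ∃ w, toCusp h w = x ∧ cross p w = 1 := by
  obtain ⟨w, rfl⟩ := toCusp_surjective x
  obtain ⟨k, hk⟩ := cuspGraph_adj.1 hx
  refine ⟨ζ ^ (5 * k) • w, (toCusp_eq_iff.2 ⟨5 * k, rfl⟩).symm, ?_⟩
  have := cross_smul_smul 1 (ζ ^ (5 * k)) p w
  rw [one_smul] at this
  rw [this, hk, one_mul, h.pow_mul_pow]

lemma near_iff {p v w : S × S} (hv : cross p v = 1) (hw : cross p w = 1) :
    Near (cuspGraph h) (toCusp h v) (toCusp h w) ↔ IsSmall ζ (cross v w) := by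
  refine or_congr ⟨fun e => ?_, fun e => by rw [eq_of_cross_eq_zero hv hw e]⟩ cuspGraph_adj
  obtain ⟨k, rfl⟩ := toCusp_eq_iff.1 e
  simp only [cross, Prod.smul_fst, Prod.smul_snd, smul_eq_mul]
  ring

lemma isSmall_of_adj {v w : S × S} (e : (cuspGraph h).Adj (toCusp h v) (toCusp h w)) :
    IsSmall ζ (cross v w) := Or.inr (cuspGraph_adj.1 e)

lemma cross_self (v : S × S) : cross v v = 0 := by
  simp only [cross]
  ring

variable (h) in
lemma locallySixLarge_cuspGraph : LocallySixLarge (cuspGraph h) where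
  four := by
    intro p x₁ x₂ x₃ x₄ h₁ h₂ h₃ h₄ h₁₂ h₂₃ h₃₄ h₄₁
    obtain ⟨p, rfl⟩ := toCusp_surjective p
    obtain ⟨w₁, rfl, e₁⟩ := exists_rep_of_adj h₁
    obtain ⟨w₂, rfl, e₂⟩ := exists_rep_of_adj h₂
    obtain ⟨w₃, rfl, e₃⟩ := exists_rep_of_adj h₃
    obtain ⟨w₄, rfl, e₄⟩ := exists_rep_of_adj h₄
    rw [near_iff e₁ e₃, near_iff e₂ e₄, ← cross_add_cross e₁ e₂ e₃, ← cross_add_cross e₂ e₃ e₄]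
    refine h.quadrangle (isSmall_of_adj h₁₂) (isSmall_of_adj h₂₃) (isSmall_of_adj h₃₄)
      (isSmall_of_adj h₄₁) ?_
    rw [cross_add_cross e₁ e₂ e₃, cross_add_cross e₁ e₃ e₄, cross_add_cross e₁ e₄ e₁, cross_self]
  five := by
    intro p x₁ x₂ x₃ x₄ x₅ h₁ h₂ h₃ h₄ h₅ h₁₂ h₂₃ h₃₄ h₄₅ h₅₁
    obtain ⟨p, rfl⟩ := toCusp_surjective p
    obtain ⟨w₁, rfl, e₁⟩ := exists_rep_of_adj h₁
    obtain ⟨w₂, rfl, e₂⟩ := exists_rep_of_adj h₂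
    obtain ⟨w₃, rfl, e₃⟩ := exists_rep_of_adj h₃
    obtain ⟨w₄, rfl, e₄⟩ := exists_rep_of_adj h₄
    obtain ⟨w₅, rfl, e₅⟩ := exists_rep_of_adj h₅
    rw [near_iff e₁ e₃, near_iff e₂ e₄, near_iff e₃ e₅, ← cross_add_cross e₁ e₂ e₃,
      ← cross_add_cross e₂ e₃ e₄, ← cross_add_cross e₃ e₄ e₅]
    have hs : cross w₁ w₂ + cross w₂ w₃ + cross w₃ w₄ + cross w₄ w₅ + cross w₅ w₁ = 0 := by
      rw [cross_add_cross e₁ e₂ e₃, cross_add_cross e₁ e₃ e₄, cross_add_cross e₁ e₄ e₅,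
        cross_add_cross e₁ e₅ e₁, cross_self]
    rcases h.pentagon (isSmall_of_adj h₁₂) (isSmall_of_adj h₂₃) (isSmall_of_adj h₃₄)
      (isSmall_of_adj h₄₅) (isSmall_of_adj h₅₁) hs with e | e | e
    exacts [.inl e, .inr (.inl e), .inr (.inr (.inl e))]

lemma exists_far (p d : Cusp h) (hd : (cuspGraph h).Adj d p) : ∃ z, (cuspGraph h).Adj z p ∧
    ∀ d', (cuspGraph h).Adj d' p → Near (cuspGraph h) d d' → d' ≠ z ∧ ¬ (cuspGraph h).Adj d' z := by
  obtain ⟨p, rfl⟩ := toCusp_surjective p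
  obtain ⟨d, rfl, e⟩ := exists_rep_of_adj hd.symm
  have e' : cross p (d + (3 : S) • p) = 1 := by
    rw [← e]
    simp only [cross, Prod.fst_add, Prod.snd_add, Prod.smul_fst, Prod.smul_snd, smul_eq_mul]
    ring
  refine ⟨toCusp h (d + (3 : S) • p), (cuspGraph_adj.2 ⟨0, by rw [e', pow_zero]⟩).symm, ?_⟩
  intro d' hd' hn
  obtain ⟨d', rfl, f⟩ := exists_rep_of_adj hd'.symm
  rw [near_iff e f] at hn
  have h₃ : cross (d + (3 : S) • p) d = 3 := by
    simp only [cross, Prod.fst_add, Prod.snd_add, Prod.smul_fst, Prod.smul_snd,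
      smul_eq_mul] at e ⊢
    linear_combination 3 * e
  have key : ¬ Near (cuspGraph h) (toCusp h (d + (3 : S) • p)) (toCusp h d') := by
    rw [near_iff e' f, ← cross_add_cross e' e f, h₃]
    exact h.not_isSmall_three_add hn
  exact ⟨fun hz => key (Or.inl hz.symm), fun hz => key (Or.inr hz.symm)⟩

/-- The linear map with the given matrix entries. -/
def matMap (α β γ δ : S) (v : S × S) : S × S := (α * v.1 + β * v.2, γ * v.1 + δ * v.2)

lemma matMap_smul (α β γ δ c : S) (v : S × S) :
    matMap α β γ δ (c • v) = c • matMap α β γ δ v := by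
  ext <;> simp only [matMap, Prod.smul_fst, Prod.smul_snd, smul_eq_mul] <;> ring

lemma cross_matMap (α β γ δ : S) (v w : S × S) :
    cross (matMap α β γ δ v) (matMap α β γ δ w) = (α * δ - β * γ) * cross v w := by
  simp only [matMap, cross]
  ring

/-- The map of vertices induced by a matrix. -/
def cuspMap (h : IsHexagonal ζ) (α β γ δ : S) : Cusp h → Cusp h :=
  Quotient.map (matMap α β γ δ) (by
    rintro v _ ⟨k, rfl⟩
    exact ⟨k, matMap_smul _ _ _ _ _ _⟩)

/-- The automorphism induced by a matrix whose determinant is a power of `ζ`. -/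
def cuspIso (h : IsHexagonal ζ) (α β γ δ : S) (k : ℕ) (hk : α * δ - β * γ = ζ ^ k) :
    cuspGraph h ≃g cuspGraph h where
  toFun := cuspMap h α β γ δ
  invFun := cuspMap h δ (-β) (-γ) α
  left_inv x := by
    obtain ⟨v, rfl⟩ := toCusp_surjective x
    refine (toCusp_eq_iff.2 ⟨k, ?_⟩).symm
    rw [← hk]
    ext <;> simp only [matMap, Prod.smul_fst, Prod.smul_snd, smul_eq_mul] <;> ring
  right_inv x := by
    obtain ⟨v, rfl⟩ := toCusp_surjective x
    refine (toCusp_eq_iff.2 ⟨k, ?_⟩).symm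
    rw [← hk]
    ext <;> simp only [matMap, Prod.smul_fst, Prod.smul_snd, smul_eq_mul] <;> ring
  map_rel_iff' := by
    intro x y
    obtain ⟨v, rfl⟩ := toCusp_surjective x
    obtain ⟨w, rfl⟩ := toCusp_surjective y
    change (cuspGraph h).Adj (toCusp h (matMap α β γ δ v)) (toCusp h (matMap α β γ δ w)) ↔ _
    rw [cuspGraph_adj, cuspGraph_adj, cross_matMap, hk]
    constructor
    · rintro ⟨l, hl⟩
      refine ⟨5 * k + l, ?_⟩
      rw [pow_add, ← hl, ← mul_assoc, h.pow_mul_pow, one_mul]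
    · rintro ⟨l, hl⟩
      exact ⟨k + l, by rw [pow_add, hl]⟩

/-- The vertex at infinity. -/
def infCusp (h : IsHexagonal ζ) : Cusp h := toCusp h (1, 0)

/-- The stabilizer of the vertex at infinity. -/
abbrev InfStab (h : IsHexagonal ζ) : Subgroup (cuspGraph h ≃g cuspGraph h) :=
  MulAction.stabilizer (cuspGraph h ≃g cuspGraph h) (infCusp h)

/-- The affine map `x ↦ ζ ^ k * x + c` as an element of the stabilizer of infinity. -/
def affine (h : IsHexagonal ζ) (k : ℕ) (c : S) : InfStab h :=
  ⟨cuspIso h (ζ ^ k) c 0 1 k (by ring), by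
    change toCusp h (matMap _ _ _ _ _) = toCusp h (1, 0)
    exact (toCusp_eq_iff.2 ⟨k, by simp [matMap]⟩).symm⟩

lemma cuspIso_ext {f g : cuspGraph h ≃g cuspGraph h}
    (hfg : ∀ v, f (toCusp h v) = g (toCusp h v)) : f = g := by
  ext x
  obtain ⟨v, rfl⟩ := toCusp_surjective x
  exact hfg v

lemma affine_mul (k l : ℕ) (c d : S) :
    affine h k c * affine h l d = affine h (k + l) (ζ ^ k * d + c) := by
  refine Subtype.ext (cuspIso_ext fun v => congrArg (toCusp h) ?_)
  ext <;> simp only [matMap] <;> ring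

lemma affine_add_six (k : ℕ) (c : S) : affine h (k + 6) c = affine h k c := by
  refine Subtype.ext (cuspIso_ext fun v => congrArg (toCusp h) ?_)
  rw [pow_add, h.pow_six, mul_one]

lemma affine_zero_zero : affine h 0 0 = 1 := by
  refine Subtype.ext (cuspIso_ext fun v => congrArg (toCusp h) ?_)
  ext <;> simp [matMap]

/-- Translations as a homomorphism to the stabilizer of infinity. -/
def translation (h : IsHexagonal ζ) : Multiplicative S →* InfStab h where
  toFun c := affine h 0 c.toAdd
  map_one' := affine_zero_zero
  map_mul' c d := by
    rw [affine_mul]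
    congr 1
    rw [toAdd_mul]
    ring

theorem infinite_tessGroup_of_isHexagonal (h : IsHexagonal ζ) {a b : ℕ} (hab : a + b * ζ = 0) :
    Infinite (tessGroup 3 3 6 a b) := by
  let q := affine h 2 1
  let r := affine h 1 0
  have hr₃ : r ^ 3 = affine h 3 0 := by
    simp only [r, pow_succ, pow_zero, one_mul, affine_mul]
    congr 1
    ring
  have t₁ : q * r ^ 4 = translation h (.ofAdd 1) := by
    rw [pow_succ, hr₃]
    simp only [q, r, affine_mul]
    rw [show 2 + (3 + 1) = 0 + 6 from rfl, affine_add_six]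
    simp [translation]
  have t₂ : r * q * r ^ 3 = translation h (.ofAdd ζ) := by
    rw [hr₃]
    simp only [q, r, affine_mul]
    rw [show 1 + 2 + 3 = 0 + 6 from rfl, affine_add_six]
    simp [translation]
  let s := cuspIso h 0 ζ 1 0 4 (by linear_combination (-ζ ^ 2 - ζ) * h.sq)
  have hsv : s (infCusp h) = toCusp h (0, 1) := congrArg (toCusp h) (by simp [matMap])
  refine infinite_tessGroup (locallySixLarge_cuspGraph h) exists_far (v := infCusp h) q r s
    ?_ ?_ ?_ ?_ ?_ ?_ ?_ ?_ ?_
  · rw [hsv]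
    exact cuspGraph_adj.2 ⟨0, by simp [cross]⟩
  · intro x hx
    obtain ⟨⟨c, d⟩, rfl, e⟩ := exists_rep_of_adj hx
    obtain rfl : d = 1 := by simpa [cross] using e
    obtain ⟨m, n, rfl⟩ := h.span c
    refine ⟨m, n, ?_⟩
    rw [t₁, t₂, ← map_zpow (translation h), ← map_zpow (translation h),
      ← map_mul (translation h), ← ofAdd_zsmul, ← ofAdd_zsmul, ← ofAdd_add, hsv]
    refine congrArg (toCusp h) ?_
    simp [matMap]
  · refine cuspIso_ext fun v => (toCusp_eq_iff.2 ⟨1, ?_⟩).symm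
    ext <;> simp [matMap]
  · rw [← affine_zero_zero, ← affine_add_six]
    simp only [q, pow_succ, pow_zero, one_mul, affine_mul]
    congr 1
    linear_combination (ζ ^ 2 + ζ + 1) * h.sq
  · rw [← affine_zero_zero, ← affine_add_six]
    simp only [r, pow_succ, pow_zero, one_mul, affine_mul]
    congr 1
    ring
  · rw [← affine_zero_zero, ← affine_add_six]
    simp only [q, r, pow_succ, pow_zero, one_mul, affine_mul]
    congr 1
    linear_combination (ζ + 1) * h.sq
  · refine cuspIso_ext fun v => (toCusp_eq_iff.2 ⟨2, ?_⟩).symm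
    ext <;> simp [matMap] <;> ring
  · have hq : q⁻¹ = affine h 4 (-ζ ^ 4) := by
      rw [inv_eq_iff_mul_eq_one, affine_mul, ← affine_zero_zero,
        show 2 + 4 = 0 + 6 from rfl, affine_add_six]
      congr 1
      linear_combination -h.pow_six
    rw [hq]
    have h₃ : ζ ^ 3 + 1 = 0 := by linear_combination (ζ + 1) * h.sq
    refine cuspIso_ext fun v => congrArg (toCusp h) ?_
    ext <;> simp [matMap]
    · linear_combination ((ζ ^ 6 - ζ ^ 3 + 1) * -v.1 + ζ ^ 6 * v.2) * h₃
    · linear_combination (ζ ^ 9 * v.1 - (ζ ^ 9 + ζ ^ 6 - ζ ^ 3 + 1) * v.2) * h₃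
  · rw [t₁, t₂, ← map_pow (translation h), ← map_pow (translation h), ← map_mul (translation h),
      ← ofAdd_nsmul, ← ofAdd_nsmul, ← ofAdd_add, nsmul_one, nsmul_eq_mul, hab, ofAdd_zero, map_one]

end Hexagonal

/-- The Eisenstein integers modulo `a + b * ω`, where `ω` is a primitive sixth root of unity. -/
abbrev EisensteinQuotient (a b : ℕ) : Type :=
  QuadraticAlgebra ℤ (-1) 1 ⧸ Ideal.span {(⟨a, b⟩ : QuadraticAlgebra ℤ (-1) 1)}

/-- The image of `m + n * ω` in the quotient. -/
def eisensteinMk (a b : ℕ) (m n : ℤ) : EisensteinQuotient a b :=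
  Ideal.Quotient.mk _ ⟨m, n⟩

lemma eisensteinMk_eq (a b : ℕ) (m n : ℤ) :
    (m + n * eisensteinMk a b 0 1 : EisensteinQuotient a b) = eisensteinMk a b m n := by
  simp only [eisensteinMk]
  set f := Ideal.Quotient.mk (Ideal.span {(⟨a, b⟩ : QuadraticAlgebra ℤ (-1) 1)})
  rw [← map_intCast f m, ← map_intCast f n, ← map_mul, ← map_add]
  congr 1
  ext <;> simp

lemma isHexagonal_eisensteinMk {a b : ℕ} (hab : 6 ≤ a + b) :
    IsHexagonal (eisensteinMk a b 0 1) where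
  sq := by
    simp only [eisensteinMk]
    rw [← map_pow, ← map_one (Ideal.Quotient.mk _), ← map_sub]
    congr 1
  span x := by
    obtain ⟨⟨m, n⟩, rfl⟩ := Ideal.Quotient.mk_surjective x
    exact ⟨m, n, (eisensteinMk_eq a b m n).symm⟩
  short m n hm hn hmn e := by
    rw [eisensteinMk_eq, eisensteinMk, Ideal.Quotient.eq_zero_iff_dvd] at e
    obtain ⟨⟨c, d⟩, e⟩ := e
    obtain ⟨e₁, e₂⟩ := QuadraticAlgebra.ext_iff.1 e
    simp at e₁ e₂
    have hN : m ^ 2 + m * n + n ^ 2 = (a ^ 2 + a * b + b ^ 2) * (c ^ 2 + c * d + d ^ 2) := by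
      rw [e₁, e₂]
      ring
    have hab' : (6 : ℤ) ≤ a + b := mod_cast hab
    have h₁ : (27 : ℤ) ≤ a ^ 2 + a * b + b ^ 2 := by nlinarith [sq_nonneg ((a : ℤ) - b)]
    have h₂ : m ^ 2 + m * n + n ^ 2 ≤ 25 := by
      rw [abs_le] at hm hn hmn
      rcases le_total 0 m with h | h <;> rcases le_total 0 n with h' | h' <;>
        rcases le_total 0 (m + n) with h'' | h'' <;> nlinarith
    have h₃ : c ^ 2 + c * d + d ^ 2 ≤ 0 := by
      by_contra! hc
      nlinarith
    have hcd : c = 0 ∧ d = 0 := by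
      constructor <;> nlinarith [sq_nonneg (c + d), sq_nonneg c, sq_nonneg d]
    simp [e₁, e₂, hcd]

lemma natCast_add_mul_eisensteinMk (a b : ℕ) :
    (a + b * eisensteinMk a b 0 1 : EisensteinQuotient a b) = 0 := by
  have e := eisensteinMk_eq a b a b
  rw [Int.cast_natCast, Int.cast_natCast] at e
  rw [e, eisensteinMk, Ideal.Quotient.eq_zero_iff_dvd]

end Systolic

/-- tetrahedral case of Theorem 7.1: for integers a ≥ b ≥ 0 with
a+b ≥ 6, the group G_{3,3,6}(a,b) is infinite. -/
theorem tessGroup_336_infinite (a b : ℕ) (hab : b ≤ a) (h : 6 ≤ a + b) :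
    Infinite (tessGroup 3 3 6 a b) := by
  exact Systolic.infinite_tessGroup_of_isHexagonal (Systolic.isHexagonal_eisensteinMk h)
    (Systolic.natCast_add_mul_eisensteinMk a b)
end

section
/- For all integers a ≥ b ≥ 0 with a + b ≥ 6, the presented group G_{4,3,6}(a,b) = ⟨P, Q, R | P⁴, Q³, R⁶, (PQ)², (QR)², (PQR)², (QR⁴)^a (RQR³)^b⟩ is infinite. (This is the cubical case of Theorem 7.1: the universal regular tessellation of type {4,3,6} and cusp modulus z = a+bζ is infinite volume when the combinatorial length ‖z‖ = a+b is at least 6.) -/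
/-- A quotient of the Eisenstein integers in which the six units remain distinct, and in which
sums of two units equal to a unit are stable under conjugation `unit k ↦ unit (-k)`. -/
structure HexSystem (A : Type) [CommRing A] where
  zeta : Aˣ
  unit : ZMod 6 → A
  unit_zero : unit 0 = 1
  zeta_mul_unit : ∀ k, zeta * unit k = unit (k + 1)
  zeta_sq : (zeta : A) ^ 2 = zeta - 1
  unit_injective : Function.Injective unit
  unit_ne_zero : ∀ k, unit k ≠ 0
  conj_add : ∀ i j k, unit i + unit j = unit k → unit (-i) + unit (-j) = unit (-k)
  far : A
  far_ne_zero : far ≠ 0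
  far_ne_unit : ∀ k, far ≠ unit k
  eq_int_add : ∀ x : A, ∃ m n : ℤ, x = m + n * zeta

namespace HexSystem

variable {A : Type} [CommRing A] (U : HexSystem A)

/-- Translation of the first letter of a word. -/
def shift (x : A) : List A → List A
  | [] => []
  | c :: w => (x + c) :: w

@[simp] theorem shift_nil (x : A) : shift x [] = [] := rfl

@[simp] theorem shift_cons (x c : A) (w : List A) : shift x (c :: w) = (x + c) :: w := rfl

theorem shift_shift (x y : A) (w : List A) : shift x (shift y w) = shift (x + y) w := by
  cases w <;> simp [add_assoc]

@[simp] theorem shift_zero (w : List A) : shift 0 w = w := by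
  cases w <;> simp

@[simp] theorem shift_neg_shift (x : A) (w : List A) : shift (-x) (shift x w) = w := by
  simp [shift_shift]

@[simp] theorem shift_shift_neg (x : A) (w : List A) : shift x (shift (-x) w) = w := by
  simp [shift_shift]

@[simp] theorem length_shift (x : A) (w : List A) : (shift x w).length = w.length := by
  cases w <;> simp

/-- Words up to exchanging the order of two consecutive steps across a common square. -/
inductive Eqv : List A → List A → Prop
  | nil : Eqv [] []
  | cons (c : A) {u v : List A} : Eqv u v → Eqv (c :: u) (c :: v)
  | swap (c : A) (k : ZMod 6) (q : List A) {u v : List A} :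
      Eqv u (U.unit k :: q) → Eqv v (-U.unit k :: shift (U.unit (-k)) q) →
      Eqv (c :: u) ((c + U.unit (-k)) :: v)

variable {U}

theorem zeta_pow_three : (U.zeta : A) ^ 3 = -1 := by
  linear_combination (U.zeta + 1 : A) * U.zeta_sq

theorem zeta_pow_six : U.zeta ^ 6 = 1 := by
  ext
  push_cast
  linear_combination (U.zeta ^ 3 - 1 : A) * zeta_pow_three (U := U)

theorem unit_add_three (k : ZMod 6) : U.unit (k + 3) = -U.unit k := by
  rw [show k + 3 = k + 1 + 1 + 1 by ring, ← U.zeta_mul_unit, ← U.zeta_mul_unit,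
    ← U.zeta_mul_unit]
  linear_combination (U.unit k) * zeta_pow_three (U := U)

theorem unit_neg_add_three (k : ZMod 6) : U.unit (-(k + 3)) = -U.unit (-k) := by
  rw [← unit_add_three]
  congr 1
  revert k
  decide

namespace Eqv

theorem refl : ∀ w : List A, Eqv U w w
  | [] => nil
  | c :: w => cons c (refl w)

theorem symm {u v : List A} (h : Eqv U u v) : Eqv U v u := by
  induction h with
  | nil => exact nil
  | cons c _ ih => exact cons c ih
  | @swap c k q u v h₁ h₂ _ _ =>
    have := swap (U := U) (c + U.unit (-k)) (k + 3) (shift (U.unit (-k)) q) (u := v) (v := u)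
      (by rwa [unit_add_three])
      (by rwa [unit_add_three, unit_neg_add_three, neg_neg, shift_neg_shift])
    rwa [unit_neg_add_three, add_neg_cancel_right] at this

theorem length_eq {u v : List A} (h : Eqv U u v) : u.length = v.length := by
  induction h with
  | nil => rfl
  | cons c _ ih => simp [ih]
  | swap c k q _ _ ih₁ ih₂ => simp_all

theorem shift (x : A) {u v : List A} (h : Eqv U u v) :
    Eqv U (HexSystem.shift x u) (HexSystem.shift x v) := by
  cases h with
  | nil => exact nil
  | cons c h => exact cons _ h
  | swap c k q h₁ h₂ =>
    have := swap (U := U) (x + c) k q h₁ h₂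
    rwa [add_assoc] at this

theorem swap_cons (c : A) (k : ZMod 6) (q : List A) :
    Eqv U (c :: U.unit k :: q)
      ((c + U.unit (-k)) :: -U.unit k :: HexSystem.shift (U.unit (-k)) q) :=
  swap c k q (refl _) (refl _)

/-- Variant of `swap_cons` with the second letter the negative of a unit. -/
theorem swap_cons_neg (c : A) (k : ZMod 6) (q : List A) :
    Eqv U (c :: -U.unit k :: q)
      ((c - U.unit (-k)) :: U.unit k :: HexSystem.shift (-U.unit (-k)) q) := by
  have := swap_cons (U := U) c (k + 3) q
  rwa [unit_neg_add_three, unit_add_three, neg_neg, ← sub_eq_add_neg] at this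

theorem trans {u v w : List A} (h : Eqv U u v) (h' : Eqv U v w) : Eqv U u w := by
  induction hn : u.length using Nat.strong_induction_on generalizing u v w with
  | _ n ih =>
  subst hn
  have tr : ∀ {c : A} {t x y z : List A}, u = c :: t → t.length = x.length →
      Eqv U x y → Eqv U y z → Eqv U x z := by
    rintro c t x y z rfl hx hxy hyz
    exact ih x.length (by simp [hx]) hxy hyz rfl
  cases h with
  | nil => exact h'
  | @cons c u v h =>
    have hl := h.length_eq
    cases h' with
    | cons _ h' => exact cons c (tr rfl rfl h h')
    | swap _ k q h₁ h₂ => exact swap c k q (tr rfl rfl h h₁) h₂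
  | @swap c k y u₀ u₁ h₁ h₂ =>
    have hl₁ := h₁.length_eq
    have hl₂ := h₂.length_eq
    have hl : u₀.length = u₁.length := by simp_all
    cases h' with
    | @cons _ _ u₂ h' =>
      exact swap c k y h₁ (tr rfl (by rw [hl, h'.length_eq]) h'.symm h₂)
    | @swap _ j y' _ u₂ h₃ h₄ =>
      have hl₃ := h₃.length_eq
      have hl₄ := h₄.length_eq
      have key := tr rfl (by simp_all) h₂.symm h₃
      generalize hek : -U.unit k = ek at key
      generalize hej : U.unit j = ej at key
      generalize hsy : HexSystem.shift (U.unit (-k)) y = sy at key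
      cases key with
      | cons _ hy =>
        have hjk : j = k + 3 := U.unit_injective (by rw [hej, unit_add_three, hek])
        subst hjk
        have e₁ : c + U.unit (-k) + U.unit (-(k + 3)) = c := by
          rw [unit_neg_add_three, add_neg_cancel_right]
        rw [e₁]
        refine cons c ?_
        rw [unit_neg_add_three, unit_add_three, neg_neg] at h₄
        have hy' : Eqv U y (HexSystem.shift (-U.unit (-k)) y') := by
          have := hy.shift (-U.unit (-k))
          rwa [← hsy, shift_neg_shift] at this
        exact tr rfl rfl h₁ (tr rfl (by simp_all) (cons _ hy') h₄.symm)
      | swap _ m q h₅ h₆ =>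
        subst hek hsy
        have hsum : U.unit j + U.unit k = U.unit (-m) := by rw [hej]; abel
        have hconj := U.conj_add _ _ _ hsum
        rw [neg_neg] at hconj
        have e₁ : c + U.unit (-k) + U.unit (-j) = c + U.unit (- -m) := by
          rw [neg_neg, ← hconj]; abel
        rw [e₁]
        have hl₅ := h₅.length_eq
        have hl₆ := h₆.length_eq
        refine swap c (-m) (-U.unit (-j) :: HexSystem.shift (U.unit j) q) ?_ ?_
        · have hy : Eqv U y (U.unit (-j) :: q) := by
            have := h₅.shift (-U.unit (-k))
            rw [shift_neg_shift, shift_cons] at this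
            convert this using 2
            rw [← hconj]; abel
          have := swap_cons (U := U) (U.unit k) (-j) q
          rw [neg_neg, add_comm, hsum] at this
          exact tr rfl rfl h₁ (tr rfl hl₁ (cons _ hy) this)
        · have hy : Eqv U (-U.unit j :: HexSystem.shift (U.unit (-j)) y')
              (-U.unit j :: -U.unit (-k) :: HexSystem.shift (U.unit (-m)) q) := by
            have := h₆.shift (U.unit (-j))
            rw [shift_cons] at this
            convert cons _ this using 3
            rw [← hconj]; abel
          have := swap_cons_neg (U := U) (-U.unit j) (-k) (HexSystem.shift (U.unit (-m)) q)
          rw [neg_neg, shift_shift] at this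
          have e₂ : -U.unit j - U.unit k = -U.unit (-m) := by rw [← hsum]; abel
          have e₃ : -U.unit k + U.unit (-m) = U.unit j := by rw [← hsum]; abel
          rw [e₂, e₃] at this
          have hlen : u₀.length = u₂.length := by
            simp only [List.length_cons, length_shift] at hl₂ hl₃ hl₄
            omega
          have h₇ := tr rfl hlen h₄ (tr rfl (hlen.trans hl₄) hy this)
          rw [neg_neg, shift_cons]
          convert h₇ using 3
          rw [← hconj]; abel

end Eqv

/-- The word can be rewritten to start by crossing the reference edge. -/
def Returns (U : HexSystem A) (w : List A) : Prop := ∃ u, Eqv U w (0 :: u)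

/-- No rewriting of the word crosses an edge and immediately crosses it back. -/
def Reduced (U : HexSystem A) : List A → Prop
  | [] => True
  | _ :: w => Reduced U w ∧ ¬ Returns U w

theorem Eqv.returns_iff {u v : List A} (h : Eqv U u v) : Returns U u ↔ Returns U v :=
  ⟨fun ⟨p, hp⟩ => ⟨p, h.symm.trans hp⟩, fun ⟨p, hp⟩ => ⟨p, h.trans hp⟩⟩

theorem reduced_shift {x : A} {w : List A} : Reduced U (shift x w) ↔ Reduced U w := by
  cases w <;> rfl

theorem Eqv.of_cons {c : A} {u v : List A} (h : Eqv U (c :: u) (c :: v)) : Eqv U u v := by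
  generalize hd : c = d at h
  nth_rewrite 1 [← hd] at h
  cases h with
  | cons _ h => exact h
  | swap _ k q _ _ => simp [U.unit_ne_zero] at hd

theorem Eqv.of_shift {x : A} {u v : List A} (h : Eqv U (HexSystem.shift x u) v) :
    Eqv U u (HexSystem.shift (-x) v) := by
  simpa using h.shift (-x)

theorem reduced_cons_unit {k : ZMod 6} {q : List A} {c : A}
    (h : Reduced U (c :: U.unit k :: q)) :
    Reduced U (-U.unit k :: shift (U.unit (-k)) q) ∧
      ¬ Returns U (-U.unit k :: shift (U.unit (-k)) q) := by
  obtain ⟨⟨hq, hzq⟩, hz⟩ := h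
  refine ⟨⟨reduced_shift.2 hq, ?_⟩, ?_⟩
  · rintro ⟨p, hp⟩
    apply hz
    have h₁ := hp.of_shift
    rw [shift_cons, add_zero] at h₁
    have h₂ := Eqv.swap_cons_neg (U := U) (U.unit k) (-k) p
    rw [neg_neg, sub_self] at h₂
    exact ⟨_, (Eqv.cons _ h₁).trans h₂⟩
  · rintro ⟨p, hp⟩
    generalize hd : -U.unit k = d at hp
    generalize hs : shift (U.unit (-k)) q = s at hp
    generalize hz' : (0 : A) = z at hp
    cases hp with
    | cons _ hp => exact U.unit_ne_zero k (by rw [← neg_neg (U.unit k), hd, ← hz', neg_zero])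
    | swap _ m p' h₁ h₂ =>
      subst hd hs
      have hm : k = -m := U.unit_injective (by rw [eq_comm, ← sub_eq_zero, hz']; abel)
      apply hzq
      have h₃ := h₁.of_shift
      rw [hm, neg_neg, shift_cons, neg_add_cancel] at h₃
      exact ⟨_, h₃⟩

theorem Eqv.reduced {u v : List A} (h : Eqv U u v) (hu : Reduced U u) : Reduced U v := by
  induction hn : u.length using Nat.strong_induction_on generalizing u v with
  | _ n ih =>
  subst hn
  cases h with
  | nil => exact hu
  | cons c h =>
    exact ⟨ih _ (by simp) h hu.1 rfl, fun hv => hu.2 (h.returns_iff.2 hv)⟩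
  | @swap c k q u v h₁ h₂ =>
    have h₃ : Reduced U (c :: U.unit k :: q) :=
      ⟨ih _ (by simp) h₁ hu.1 rfl, fun hv => hu.2 (h₁.returns_iff.2 hv)⟩
    obtain ⟨h₄, h₅⟩ := reduced_cons_unit h₃
    have hl₁ := h₁.length_eq
    refine ⟨ih _ ?_ h₂.symm h₄ rfl, fun hv => h₅ (h₂.returns_iff.1 hv)⟩
    simp at hl₁ ⊢
    omega

instance wordSetoid (U : HexSystem A) : Setoid {w : List A // Reduced U w} where
  r u v := Eqv U u v
  iseqv := ⟨fun _ => Eqv.refl _, Eqv.symm, Eqv.trans⟩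

/-- Reduced words up to square moves. -/
def Vertex (U : HexSystem A) : Type := Quotient (wordSetoid U)

namespace Vertex

/-- The class of a reduced word. -/
def mk (w : List A) (h : Reduced U w) : Vertex U := Quotient.mk _ ⟨w, h⟩

theorem mk_eq_mk {u v : List A} {hu : Reduced U u} {hv : Reduced U v} :
    mk u hu = mk v hv ↔ Eqv U u v :=
  Quotient.eq (r := wordSetoid U)

theorem mk_congr {u v : List A} (h : Eqv U u v) (hu : Reduced U u) (hv : Reduced U v) :
    mk u hu = mk v hv :=
  mk_eq_mk.2 h

theorem exists_rep (x : Vertex U) : ∃ w h, x = mk w h := by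
  induction x using Quotient.inductionOn with
  | _ w => exact ⟨w.1, w.2, rfl⟩

/-- The number of edges crossed by a representing word. -/
def length (x : Vertex U) : ℕ :=
  Quotient.lift (fun w : {w : List A // Reduced U w} => w.1.length) (fun _ _ h => Eqv.length_eq h) x

@[simp] theorem length_mk (w : List A) (h : Reduced U w) : (mk w h).length = w.length := rfl

/-- Change of the reference edge. -/
def translate (a : A) (x : Vertex U) : Vertex U :=
  Quotient.map (fun w => ⟨shift a w.1, reduced_shift.2 w.2⟩) (fun _ _ h => Eqv.shift a h) x

@[simp] theorem translate_mk (a : A) (w : List A) (h : Reduced U w) :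
    translate a (mk w h) = mk (shift a w) (reduced_shift.2 h) := rfl

theorem translate_translate (a b : A) (x : Vertex U) :
    translate a (translate b x) = translate (a + b) x := by
  obtain ⟨w, h, rfl⟩ := x.exists_rep
  simp [shift_shift]

@[simp] theorem translate_zero (x : Vertex U) : translate 0 x = x := by
  obtain ⟨w, h, rfl⟩ := x.exists_rep
  simp

/-- Two vertices joined by their common reference edge. -/
def Adj (x y : Vertex U) : Prop :=
  ∃ w h h', (x = mk (0 :: w) h ∧ y = mk w h') ∨ (x = mk w h' ∧ y = mk (0 :: w) h)

theorem Adj.symm {x y : Vertex U} (h : Adj x y) : Adj y x := by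
  obtain ⟨w, h, h', ⟨hx, hy⟩ | ⟨hx, hy⟩⟩ := h
  · exact ⟨w, h, h', .inr ⟨hy, hx⟩⟩
  · exact ⟨w, h, h', .inl ⟨hy, hx⟩⟩

theorem exists_adj (x : Vertex U) : ∃ y, Adj x y := by
  obtain ⟨w, h, rfl⟩ := x.exists_rep
  by_cases hw : Returns U w
  · obtain ⟨u, hu⟩ := hw
    have h₁ := hu.reduced h
    exact ⟨mk u h₁.1, u, h₁, h₁.1, .inl ⟨mk_eq_mk.2 hu, rfl⟩⟩
  · exact ⟨mk (0 :: w) ⟨h, hw⟩, w, ⟨h, hw⟩, h, .inr ⟨rfl, rfl⟩⟩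

theorem Adj.eq {x y z : Vertex U} (hy : Adj x y) (hz : Adj x z) : y = z := by
  obtain ⟨w, h, h', ⟨rfl, rfl⟩ | ⟨rfl, rfl⟩⟩ := hy <;>
    obtain ⟨v, k, k', ⟨hx, rfl⟩ | ⟨hx, rfl⟩⟩ := hz <;> rw [mk_eq_mk] at hx ⊢
  · exact hx.of_cons
  · exact absurd ⟨w, hx.symm⟩ k.2
  · exact absurd ⟨v, hx⟩ h.2
  · exact .cons _ hx

/-- Crossing the reference edge. -/
noncomputable def cross (x : Vertex U) : Vertex U := (exists_adj x).choose

theorem Adj.cross_eq {x y : Vertex U} (h : Adj x y) : cross x = y :=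
  (exists_adj x).choose_spec.eq h

theorem adj_cross (x : Vertex U) : Adj x (cross x) := (exists_adj x).choose_spec

@[simp] theorem cross_cross (x : Vertex U) : cross (cross x) = x :=
  (adj_cross x).symm.cross_eq

theorem cross_mk {w : List A} (h : Reduced U (0 :: w)) : cross (mk w h.1) = mk (0 :: w) h :=
  Adj.cross_eq ⟨w, h, h.1, .inr ⟨rfl, rfl⟩⟩

theorem cross_mk_zero_cons {w : List A} (h : Reduced U (0 :: w)) :
    cross (mk (0 :: w) h) = mk w h.1 :=
  Adj.cross_eq ⟨w, h, h.1, .inl ⟨rfl, rfl⟩⟩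

/-- Crossing the edge at position `unit k`. -/
noncomputable def step (k : ZMod 6) (x : Vertex U) : Vertex U := cross (translate (-U.unit k) x)

theorem step_injective (k : ZMod 6) : Function.Injective (step (U := U) k) := by
  intro x y h
  have := congrArg (fun t => translate (U.unit k) (cross t)) h
  simpa [step, translate_translate] using this

theorem step_three_sub (k : ZMod 6) (x : Vertex U) :
    step (3 - k) x = cross (translate (U.unit (-k)) x) := by
  rw [step, show 3 - k = -k + 3 by ring, unit_add_three, neg_neg]

/-- Walking around the square spanned by the reference edge and the edge `unit k`. -/
def Closes (k : ZMod 6) (x : Vertex U) : Prop :=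
  step (3 - k) (step k (step (3 - k) (step k x))) = x

theorem closes_step_iff {k : ZMod 6} {x : Vertex U} : Closes (3 - k) (step k x) ↔ Closes k x := by
  unfold Closes
  rw [sub_sub_cancel, (step_injective k).eq_iff]

theorem closes_of_not_returns {k : ZMod 6} {w : List A} (h : Reduced U w) (h₀ : ¬ Returns U w)
    (hk : ¬ Returns U (shift (-U.unit k) w)) : Closes k (mk w h) := by
  have r₁ : Reduced U (0 :: shift (-U.unit k) w) := ⟨reduced_shift.2 h, hk⟩
  have r₂ : Reduced U (0 :: U.unit (-k) :: shift (-U.unit k) w) := by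
    refine ⟨r₁, ?_⟩
    rintro ⟨p, hp⟩
    generalize hd : U.unit (-k) = d at hp
    generalize hs : shift (-U.unit k) w = s at hp
    generalize hz : (0 : A) = z at hp
    cases hp with
    | cons _ hp => exact U.unit_ne_zero _ (hd.trans hz.symm)
    | swap _ m q h₁ h₂ =>
      subst hd hs
      have hm : m = k + 3 := by
        have h₃ : U.unit (-m) = U.unit (-(k + 3)) := by
          rw [unit_neg_add_three, ← sub_eq_zero, hz]; abel
        exact neg_injective (U.unit_injective h₃)
      have h₃ := h₁.of_shift
      rw [hm, unit_add_three, neg_neg, shift_cons, add_neg_cancel] at h₃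
      exact h₀ ⟨_, h₃⟩
  have e : Eqv U (0 :: U.unit (-k) :: shift (-U.unit k) w)
      (U.unit k :: -U.unit (-k) :: w) := by
    have := Eqv.swap_cons (U := U) 0 (-k) (shift (-U.unit k) w)
    rwa [neg_neg, shift_shift_neg, zero_add] at this
  have r₃ := e.reduced r₂
  have r₄ : Reduced U (0 :: -U.unit (-k) :: w) := r₃
  have r₅ : Reduced U (0 :: w) := ⟨h, h₀⟩
  have s₁ : step k (mk w h) = mk _ r₁ := cross_mk r₁
  have s₂ : step (3 - k) (mk _ r₁) = mk _ r₃ := by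
    rw [step_three_sub, ← mk_congr e r₂ r₃]
    rw [← cross_mk r₂]
    simp
  have s₃ : step k (mk _ r₃) = mk _ r₄.1 := by
    rw [step, ← cross_mk_zero_cons r₄]
    simp
  have s₄ : step (3 - k) (mk _ r₄.1) = mk w h := by
    rw [step_three_sub]
    rw [← cross_mk_zero_cons r₅]
    simp
  rw [Closes, s₁, s₂, s₃, s₄]

theorem closes (k : ZMod 6) (x : Vertex U) : Closes k x := by
  obtain ⟨w, h, rfl⟩ := x.exists_rep
  by_cases hk : Returns U (shift (-U.unit k) w)
  · obtain ⟨p, hp⟩ := hk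
    have hr := hp.reduced (reduced_shift.2 h)
    have s₁ : step k (mk w h) = mk p hr.1 := by
      rw [step, ← cross_mk_zero_cons hr, translate_mk, mk_congr hp _ hr]
    rw [← closes_step_iff, s₁]
    by_cases hj : Returns U (shift (-U.unit (3 - k)) p)
    · obtain ⟨q, hq⟩ := hj
      have hr' := hq.reduced (reduced_shift.2 hr.1)
      have s₂ : step (3 - k) (mk p hr.1) = mk q hr'.1 := by
        rw [step, ← cross_mk_zero_cons hr', translate_mk, mk_congr hq _ hr']
      rw [← closes_step_iff, s₂, sub_sub_cancel]
      refine closes_of_not_returns _ hr'.2 ?_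
      rintro ⟨r, hrr⟩
      apply hr.2
      have h₁ := hrr.of_shift
      have h₂ := hq.of_shift
      rw [shift_cons, neg_neg, add_zero] at h₁ h₂
      have h₃ := Eqv.swap_cons (U := U) (U.unit (3 - k)) k r
      rw [show 3 - k = -k + 3 by ring, unit_add_three, neg_add_cancel] at h₃
      rw [show 3 - k = -k + 3 by ring, unit_add_three] at h₂
      exact ⟨_, h₂.trans ((Eqv.cons _ h₁).trans h₃)⟩
    · exact closes_of_not_returns _ hr.2 hj
  · by_cases h₀ : Returns U w
    · obtain ⟨p, hp⟩ := h₀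
      have hr := hp.reduced h
      have e : shift (-U.unit (3 - k)) (shift (-U.unit (-k)) p) = p := by
        rw [show 3 - k = -k + 3 by ring, unit_add_three, neg_neg, shift_shift_neg]
      have s : step (3 - k) (mk (shift (-U.unit (-k)) p) (reduced_shift.2 hr.1)) = mk w h := by
        rw [mk_congr hp _ hr, ← cross_mk hr, step, translate_mk]
        congr 2
      rw [← s]
      have := closes_step_iff (U := U) (k := 3 - k)
        (x := mk (shift (-U.unit (-k)) p) (reduced_shift.2 hr.1))
      rw [sub_sub_cancel] at this
      rw [this]
      refine closes_of_not_returns _ ?_ (by rw [e]; exact hr.2)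
      rintro ⟨r, hrr⟩
      apply hk
      have h₁ := hrr.of_shift
      rw [shift_cons, neg_neg, add_zero] at h₁
      have h₂ := Eqv.swap_cons (U := U) 0 (-k) r
      rw [neg_neg, zero_add] at h₂
      have h₃ := (hp.trans ((Eqv.cons _ h₁).trans h₂)).shift (-U.unit k)
      rw [shift_cons, neg_add_cancel] at h₃
      exact ⟨_, h₃⟩
    · exact closes_of_not_returns h h₀ hk

end Vertex

/-- Rotation of a word; it turns the letters alternately in opposite directions. -/
def rotate (g : Aˣ) : List A → List A
  | [] => []
  | c :: w => (g * c) :: rotate g⁻¹ w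

theorem rotate_rotate (g h : Aˣ) (w : List A) : rotate g (rotate h w) = rotate (g * h) w := by
  induction w generalizing g h with
  | nil => rfl
  | cons c w ih => simp [rotate, ih, mul_assoc, mul_comm h⁻¹]

theorem rotate_one (w : List A) : rotate 1 w = w := by
  induction w with
  | nil => rfl
  | cons c w ih => simp [rotate, ih]

theorem rotate_shift (g : Aˣ) (a : A) (w : List A) :
    rotate g (shift a w) = shift (g * a) (rotate g w) := by
  cases w <;> simp [rotate, mul_add]

theorem zeta_zpow_mul_unit (n : ℤ) (k : ZMod 6) :
    (U.zeta ^ n : Aˣ) * U.unit k = U.unit (k + n) := by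
  induction n with
  | zero => simp
  | succ n ih =>
    rw [zpow_add_one, mul_comm (U.zeta ^ (n : ℤ)), Units.val_mul, mul_assoc, ih, zeta_mul_unit]
    push_cast
    rw [add_assoc]
  | pred n ih =>
    rw [sub_eq_add_neg, zpow_add, mul_comm (U.zeta ^ (-n : ℤ)), Units.val_mul, mul_assoc, ih,
      zpow_neg_one, Units.inv_mul_eq_iff_eq_mul, zeta_mul_unit]
    congr 1
    push_cast
    ring

theorem Eqv.rotate (n : ℤ) {u v : List A} (h : Eqv U u v) :
    Eqv U (HexSystem.rotate (U.zeta ^ n) u) (HexSystem.rotate (U.zeta ^ n) v) := by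
  induction h generalizing n with
  | nil => exact nil
  | cons c _ ih =>
    have := ih (-n)
    rw [zpow_neg] at this
    exact cons _ this
  | swap c k q _ _ ih₁ ih₂ =>
    have h₁ := ih₁ (-n)
    have h₂ := ih₂ (-n)
    simp only [HexSystem.rotate, mul_neg, rotate_shift, mul_add, ← zpow_neg,
      zeta_zpow_mul_unit, neg_neg] at h₁ h₂ ⊢
    have e : -k + (n : ZMod 6) = -(k + (-n : ℤ)) := by push_cast; ring
    rw [e] at h₂ ⊢
    exact swap _ _ _ h₁ h₂

theorem Returns.of_rotate {n : ℤ} {w : List A} (h : Returns U (rotate (U.zeta ^ n) w)) :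
    Returns U w := by
  obtain ⟨u, hu⟩ := h
  have := hu.rotate (-n)
  rw [rotate_rotate, ← zpow_add, neg_add_cancel, zpow_zero, rotate_one, rotate, mul_zero] at this
  exact ⟨_, this⟩

theorem Reduced.rotate {w : List A} (h : Reduced U w) (n : ℤ) :
    Reduced U (HexSystem.rotate (U.zeta ^ n) w) := by
  induction w generalizing n with
  | nil => trivial
  | cons c w ih =>
    rw [HexSystem.rotate, ← zpow_neg]
    exact ⟨ih h.1 _, fun hr => h.2 hr.of_rotate⟩

namespace Vertex

/-- Rotation about the reference edge. -/
def turn (n : ℤ) (x : Vertex U) : Vertex U :=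
  Quotient.map (fun w => ⟨rotate (U.zeta ^ n) w.1, w.2.rotate n⟩) (fun _ _ h => Eqv.rotate n h) x

@[simp] theorem turn_mk (n : ℤ) (w : List A) (h : Reduced U w) :
    turn n (mk w h) = mk (rotate (U.zeta ^ n) w) (h.rotate n) := rfl

theorem turn_turn (m n : ℤ) (x : Vertex U) : turn m (turn n x) = turn (m + n) x := by
  obtain ⟨w, h, rfl⟩ := x.exists_rep
  simp [rotate_rotate, zpow_add]

theorem turn_zero (x : Vertex U) : turn 0 x = x := by
  obtain ⟨w, h, rfl⟩ := x.exists_rep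
  simp [rotate_one]

theorem turn_six (x : Vertex U) : turn 6 x = x := by
  obtain ⟨w, h, rfl⟩ := x.exists_rep
  have : U.zeta ^ (6 : ℤ) = 1 := by exact_mod_cast zeta_pow_six (U := U)
  simp [this, rotate_one]

theorem turn_translate (n : ℤ) (a : A) (x : Vertex U) :
    turn n (translate a x) = translate ((U.zeta ^ n : Aˣ) * a) (turn n x) := by
  obtain ⟨w, h, rfl⟩ := x.exists_rep
  simp [rotate_shift]

theorem turn_cross (n : ℤ) (x : Vertex U) : turn n (cross x) = cross (turn (-n) x) := by
  symm
  apply Adj.cross_eq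
  obtain ⟨w, h, h', ⟨rfl, hy⟩ | ⟨hy, hx⟩⟩ := adj_cross x
  · rw [hy]
    refine ⟨_, ?_, h'.rotate n, .inl ⟨?_, rfl⟩⟩
    · simpa [rotate] using h.rotate (-n)
    · simp [rotate]
  · rw [hx, hy]
    refine ⟨_, ?_, h'.rotate (-n), .inr ⟨rfl, ?_⟩⟩
    · simpa [rotate] using h.rotate n
    · simp [rotate]

/-- `translate` as a homomorphism to permutations. -/
def translateHom (U : HexSystem A) : Multiplicative A →* Equiv.Perm (Vertex U) where
  toFun a :=
    { toFun := translate a.toAdd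
      invFun := translate (-a.toAdd)
      left_inv := fun x => by simp [translate_translate]
      right_inv := fun x => by simp [translate_translate] }
  map_one' := by ext x; simp
  map_mul' a b := by ext x; simp [translate_translate]

/-- `turn 1` as a permutation. -/
def turnPerm (U : HexSystem A) : Equiv.Perm (Vertex U) where
  toFun := turn 1
  invFun := turn (-1)
  left_inv x := by simp [turn_turn, turn_zero]
  right_inv x := by simp [turn_turn, turn_zero]

/-- `cross` as a permutation. -/
noncomputable def crossPerm (U : HexSystem A) : Equiv.Perm (Vertex U) where
  toFun := cross
  invFun := cross
  left_inv := cross_cross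
  right_inv := cross_cross

@[simp] theorem translateHom_apply (a : Multiplicative A) (x : Vertex U) :
    translateHom U a x = translate a.toAdd x := rfl

@[simp] theorem crossPerm_apply (x : Vertex U) : crossPerm U x = cross x := rfl

@[simp] theorem turnPerm_pow_apply (n : ℕ) (x : Vertex U) : (turnPerm U ^ n) x = turn n x := by
  induction n with
  | zero => simp [turn_zero]
  | succ n ih =>
    rw [pow_succ', Equiv.Perm.mul_apply, ih]
    change turn 1 (turn n x) = _
    rw [turn_turn, add_comm]
    push_cast
    rfl

@[simp] theorem turnPerm_apply (x : Vertex U) : turnPerm U x = turn 1 x := rfl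

/-- Images of the generators of the tessellation group. -/
noncomputable def generator (U : HexSystem A) : Fin 3 → Equiv.Perm (Vertex U) :=
  ![crossPerm U * translateHom U (.ofAdd 1) * turnPerm U ^ 3,
    translateHom U (.ofAdd 1) * turnPerm U ^ 2, turnPerm U]

theorem translate_mul_turn_pow :
    translateHom U (.ofAdd 1) * turnPerm U ^ 2 * turnPerm U ^ 4 = translateHom U (.ofAdd 1) := by
  ext x
  simp [turn_turn, turn_six]

theorem turn_mul_translate_mul_turn_pow :
    turnPerm U * (translateHom U (.ofAdd 1) * turnPerm U ^ 2) * turnPerm U ^ 3 =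
      translateHom U (.ofAdd (U.zeta : A)) := by
  ext x
  simp [turn_turn, turn_six, turn_translate]

theorem generator_rels {a b : ℕ} (hz : (a : A) + b * U.zeta = 0) :
    ∀ r ∈ tessRels 4 3 6 a b, FreeGroup.lift (generator U) r = 1 := by
  have h0 : U.unit 0 = 1 := U.unit_zero
  have h3 : U.unit 3 = -1 := by rw [← h0, ← unit_add_three]; rfl
  have hz₃ : (U.zeta : A) * (U.zeta * U.zeta) = -1 := by
    linear_combination zeta_pow_three (U := U)
  have hz₃' : (↑U.zeta⁻¹ : A) * (↑U.zeta⁻¹ * ↑U.zeta⁻¹) = -1 := by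
    linear_combination (↑U.zeta⁻¹ : A) ^ 3 * hz₃ -
      (1 + U.zeta * ↑U.zeta⁻¹ + (U.zeta * ↑U.zeta⁻¹ : A) ^ 2) * U.zeta.mul_inv
  have hz₅ : (1 : A) + U.zeta * (U.zeta * (1 + U.zeta * U.zeta)) = 0 := by
    linear_combination U.zeta_sq + (U.zeta : A) * zeta_pow_three (U := U)
  intro r hr
  simp only [tessRels, Set.mem_insert_iff, Set.mem_singleton_iff] at hr
  rcases hr with rfl | rfl | rfl | rfl | rfl | rfl | rfl <;>
    simp only [map_pow, map_mul, FreeGroup.lift_apply_of, generator, Matrix.cons_val]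
  · ext x
    have := closes 0 x
    simp only [Closes, step, sub_zero, h0, h3, neg_neg] at this
    simp [pow_succ, turn_turn, turn_translate, turn_cross, turn_zero, hz₃, hz₃', this]
  · ext x
    simp [pow_succ, turn_turn, turn_translate, turn_six, translate_translate, hz₅]
  · ext x
    simp [turn_six]
  · ext x
    simp [pow_succ, turn_turn, turn_translate, turn_cross, turn_zero, translate_translate, hz₃]
  · ext x
    simp [pow_succ, turn_turn, turn_translate, turn_six, translate_translate, hz₃]
  · ext x
    simp [pow_succ, turn_turn, turn_translate, turn_cross, turn_zero, translate_translate, hz₃]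
  · norm_num only
    rw [translate_mul_turn_pow, turn_mul_translate_mul_turn_pow, ← map_pow (translateHom U),
      ← map_pow (translateHom U), ← map_mul (translateHom U), ← ofAdd_nsmul, ← ofAdd_nsmul,
      ← ofAdd_add]
    simp [hz]

theorem exists_length_translate_cross (x : Vertex U) :
    ∃ a, (cross (translate a x)).length = x.length + 1 := by
  obtain ⟨w, h, rfl⟩ := x.exists_rep
  obtain ⟨a, ha⟩ : ∃ a, ¬ Returns U (shift a w) := by
    cases w with
    | nil => exact ⟨0, fun ⟨u, hu⟩ => by simpa using hu.length_eq⟩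
    | cons c u =>
      refine ⟨U.far - c, ?_⟩
      rintro ⟨p, hp⟩
      rw [shift_cons, sub_add_cancel] at hp
      generalize hd : (0 : A) = d at hp
      cases hp with
      | cons _ hp => exact U.far_ne_zero hd.symm
      | swap _ k q _ _ =>
        apply U.far_ne_unit (-k + 3)
        rw [unit_add_three]
        linear_combination -hd
  have hr : Reduced U (0 :: shift a w) := ⟨reduced_shift.2 h, ha⟩
  refine ⟨a, ?_⟩
  rw [translate_mk, cross_mk hr]
  simp

theorem translateHom_mem {H : Subgroup (Equiv.Perm (Vertex U))} (hH : ∀ i, generator U i ∈ H)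
    (a : A) : translateHom U (.ofAdd a) ∈ H := by
  have h₁ : translateHom U (.ofAdd 1) ∈ H := by
    rw [← translate_mul_turn_pow]
    exact mul_mem (hH 1) (pow_mem (hH 2) 4)
  have hζ : translateHom U (.ofAdd (U.zeta : A)) ∈ H := by
    rw [← turn_mul_translate_mul_turn_pow]
    exact mul_mem (mul_mem (hH 2) (hH 1)) (pow_mem (hH 2) 3)
  obtain ⟨m, n, rfl⟩ := U.eq_int_add a
  have := mul_mem (zpow_mem h₁ m) (zpow_mem hζ n)
  rw [← map_zpow (translateHom U), ← map_zpow (translateHom U), ← map_mul (translateHom U),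
    ← ofAdd_zsmul, ← ofAdd_zsmul, ← ofAdd_add] at this
  simpa using this

theorem crossPerm_mem {H : Subgroup (Equiv.Perm (Vertex U))} (hH : ∀ i, generator U i ∈ H) :
    crossPerm U ∈ H := by
  have h₀ : crossPerm U * translateHom U (.ofAdd 1) * turnPerm U ^ 3 ∈ H := hH 0
  have h₁ := mul_mem (translateHom_mem hH 1) (pow_mem (show turnPerm U ∈ H from hH 2) 3)
  rwa [mul_assoc, H.mul_mem_cancel_right h₁] at h₀

end Vertex

open Vertex in
theorem infinite_tessGroup {a b : ℕ} (U : HexSystem A) (hz : (a : A) + b * U.zeta = 0) :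
    Infinite (tessGroup 4 3 6 a b) := by
  let φ : PresentedGroup (tessRels 4 3 6 a b) →* Equiv.Perm (Vertex U) :=
    PresentedGroup.toGroup (generator_rels hz)
  have hφ : ∀ i, generator U i ∈ φ.range := fun i => ⟨.of i, PresentedGroup.toGroup.of _⟩
  have hnil : Reduced U [] := trivial
  suffices Function.Surjective
    (fun g : PresentedGroup (tessRels 4 3 6 a b) => (φ g (Vertex.mk [] hnil)).length) from
    Infinite.of_surjective _ this
  intro n
  induction n with
  | zero => exact ⟨1, by simp⟩
  | succ n ih =>
    obtain ⟨g : PresentedGroup (tessRels 4 3 6 a b), hg⟩ := ih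
    obtain ⟨c, hc⟩ := exists_length_translate_cross (φ g (Vertex.mk [] hnil))
    obtain ⟨k, hk⟩ := mul_mem (crossPerm_mem hφ) (translateHom_mem hφ c)
    refine ⟨k * g, ?_⟩
    dsimp only at hg ⊢
    rw [map_mul, hk, Equiv.Perm.mul_apply, Equiv.Perm.mul_apply, translateHom_apply,
      crossPerm_apply, toAdd_ofAdd, hc, hg]

end HexSystem

/-- The Eisenstein integers, with `ω` a primitive sixth root of unity. -/
abbrev Eisenstein : Type := QuadraticAlgebra ℤ (-1) 1

namespace Eisenstein

/-- The six units, in cyclic order. -/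
def hexUnit : ZMod 6 → Eisenstein :=
  ![⟨1, 0⟩, ⟨0, 1⟩, ⟨-1, 1⟩, ⟨-1, 0⟩, ⟨0, -1⟩, ⟨1, -1⟩]

theorem norm_eq (x : Eisenstein) : x.norm = x.re ^ 2 + x.re * x.im + x.im ^ 2 := by
  rw [QuadraticAlgebra.norm_def]
  ring

theorem norm_nonneg (x : Eisenstein) : 0 ≤ x.norm := by
  rw [norm_eq]
  nlinarith [sq_nonneg (x.re + x.im), sq_nonneg x.re, sq_nonneg x.im]

theorem eq_zero_of_norm_eq_zero {x : Eisenstein} (h : x.norm = 0) : x = 0 := by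
  rw [norm_eq] at h
  ext
  · exact pow_eq_zero_iff two_ne_zero |>.1
      (show x.re ^ 2 = 0 by nlinarith [sq_nonneg (x.re + x.im), sq_nonneg x.re, sq_nonneg x.im])
  · exact pow_eq_zero_iff two_ne_zero |>.1
      (show x.im ^ 2 = 0 by nlinarith [sq_nonneg (x.re + x.im), sq_nonneg x.re, sq_nonneg x.im])

/-- A proper multiple of a nonzero element cannot have smaller norm. -/
theorem eq_zero_of_dvd {z x : Eisenstein} (h : z ∣ x) (hn : x.norm < z.norm) : x = 0 :=
  eq_zero_of_norm_eq_zero <|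
    Int.eq_zero_of_dvd_of_nonneg_of_lt (norm_nonneg x) hn (map_dvd QuadraticAlgebra.norm h)

theorem norm_hexUnit_add_sub_le (i j k : ZMod 6) :
    (hexUnit i + hexUnit j - hexUnit k).norm ≤ 9 := by
  simp only [norm_eq]
  revert i j k
  decide

theorem hexUnit_conj_add (i j k : ZMod 6) (h : hexUnit i + hexUnit j = hexUnit k) :
    hexUnit (-i) + hexUnit (-j) = hexUnit (-k) := by
  revert i j k
  decide

/-- A quotient of the Eisenstein integers by an element of large norm. -/
def quotientHexSystem (z : Eisenstein) (hz : 9 < z.norm) :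
    HexSystem (Eisenstein ⧸ Ideal.span {z}) :=
  have eq_of_mk_eq {x y : Eisenstein} (hn : (x - y).norm ≤ 9)
      (h : Ideal.Quotient.mk (Ideal.span {z}) x = Ideal.Quotient.mk (Ideal.span {z}) y) :
      x = y := by
    rw [Ideal.Quotient.eq, Ideal.mem_span_singleton] at h
    exact sub_eq_zero.1 (eq_zero_of_dvd h (hn.trans_lt hz))
  { zeta := Units.map (Ideal.Quotient.mk (Ideal.span {z})).toMonoidHom
      ⟨⟨0, 1⟩, ⟨1, -1⟩, by decide, by decide⟩
    unit := fun k => Ideal.Quotient.mk _ (hexUnit k)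
    unit_zero := map_one (Ideal.Quotient.mk _)
    zeta_mul_unit := fun k =>
      (map_mul (Ideal.Quotient.mk _) ⟨0, 1⟩ (hexUnit k)).symm.trans
        (congrArg (Ideal.Quotient.mk _) (by revert k; decide))
    zeta_sq := congrArg (Ideal.Quotient.mk (Ideal.span {z}))
      (show (⟨0, 1⟩ : Eisenstein) ^ 2 = ⟨0, 1⟩ - 1 by decide)
    unit_injective := fun i j h => by
      have := eq_of_mk_eq (by clear h; simp only [norm_eq]; revert i j; decide) h
      clear h
      revert i j
      decide
    unit_ne_zero := fun k h => by
      have := eq_of_mk_eq (y := 0) (by clear h; simp only [norm_eq]; revert k; decide) h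
      clear h
      revert k
      decide
    conj_add := fun i j k h => by
      rw [← map_add] at h ⊢
      rw [hexUnit_conj_add i j k (eq_of_mk_eq (norm_hexUnit_add_sub_le i j k) h)]
    far := Ideal.Quotient.mk _ 2
    far_ne_zero := fun h => by
      have := eq_of_mk_eq (y := 0) (by simp only [norm_eq]; decide) h
      revert this
      decide
    far_ne_unit := fun k h => by
      have := eq_of_mk_eq (by clear h; simp only [norm_eq]; revert k; decide) h
      clear h
      revert k
      decide
    eq_int_add := fun x => by
      obtain ⟨x, rfl⟩ := Ideal.Quotient.mk_surjective x
      refine ⟨x.re, x.im, ?_⟩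
      rw [← map_intCast (Ideal.Quotient.mk (Ideal.span {z})),
        ← map_intCast (Ideal.Quotient.mk (Ideal.span {z}))]
      refine congrArg (Ideal.Quotient.mk _)
        (show x = (x.re : Eisenstein) + (x.im : Eisenstein) * ⟨0, 1⟩ from ?_)
      ext <;> simp }

end Eisenstein

/-- cubical case of Theorem 7.1: for integers a ≥ b ≥ 0 with
a+b ≥ 6, the group G_{4,3,6}(a,b) is infinite. -/
theorem tessGroup_436_infinite (a b : ℕ) (hab : b ≤ a) (h : 6 ≤ a + b) :
    Infinite (tessGroup 4 3 6 a b) := by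
  have hz : 9 < QuadraticAlgebra.norm (⟨a, b⟩ : Eisenstein) := by
    rw [Eisenstein.norm_eq]
    zify at h
    nlinarith [sq_nonneg ((a : ℤ) - b)]
  refine HexSystem.infinite_tessGroup (Eisenstein.quotientHexSystem _ hz) ?_
  have hmem : Ideal.Quotient.mk (Ideal.span {(⟨a, b⟩ : Eisenstein)}) ⟨a, b⟩ = 0 :=
    Ideal.Quotient.eq_zero_iff_mem.2 (Ideal.mem_span_singleton_self _)
  rw [← hmem, ← map_natCast (Ideal.Quotient.mk (Ideal.span {(⟨a, b⟩ : Eisenstein)})),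
    ← map_natCast (Ideal.Quotient.mk (Ideal.span {(⟨a, b⟩ : Eisenstein)}))]
  refine congrArg (Ideal.Quotient.mk _)
    (show (a : Eisenstein) + (b : Eisenstein) * ⟨0, 1⟩ = ⟨a, b⟩ from ?_)
  ext <;> simp
end
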